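/- arXiv:alg-geom/9402005 — 6 statements merged into one kernel-verified Lean document; each statement's English description precedes it below -/
import Mathlib

section
/- For all integers k ≥ 1 and n ≥ 1, the sequence 0 → S_{k−1} ⊗ V_{n−1} →β S_k ⊗ V_n →μ V_{k+n} → 0 is exact, where β is the linear map determined by β(f ⊗ v) = sf ⊗ tv − tf ⊗ sv for f ∈ S_{k−1}, v ∈ V_{n−1}, and μ is determined by μ(f ⊗ (w ⊗ g)) = w ⊗ (fg) for w ∈ U, g ∈ S_n. That is: β is injective, μ is surjective, and the kernel of μ equals the image of β. -/
open scoped TensorProduct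
open MvPolynomial

noncomputable section

set_option maxHeartbeats 1000000
set_option synthInstance.maxHeartbeats 1000000

variable (K : Type) [Field K] [CharZero K]

set_option linter.unusedSectionVars false

/-- `S K m` is the space of homogeneous polynomials of degree `m` in the two variables
`s = X 0` and `t = X 1`, with the convention `S K m = 0` for `m < 0`. -/
def S (m : ℤ) : Submodule K (MvPolynomial (Fin 2) K) :=
  if 0 ≤ m then homogeneousSubmodule (Fin 2) K m.toNat else ⊥

/-- The basis vector `s` of `U = S K 1`. -/
def sU : S K 1 := ⟨X 0, by
  simp only [S, if_pos (by norm_num : (0:ℤ) ≤ 1), Int.toNat_one, mem_homogeneousSubmodule]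
  exact isHomogeneous_X _ _⟩

/-- The basis vector `t` of `U = S K 1`. -/
def tU : S K 1 := ⟨X 1, by
  simp only [S, if_pos (by norm_num : (0:ℤ) ≤ 1), Int.toNat_one, mem_homogeneousSubmodule]
  exact isHomogeneous_X _ _⟩

lemma mul_mem_S {a b c : ℤ} (h : c = a + b) {p q : MvPolynomial (Fin 2) K}
    (hp : p ∈ S K a) (hq : q ∈ S K b) : p * q ∈ S K c := by
  by_cases ha : 0 ≤ a
  · by_cases hb : 0 ≤ b
    · have hc : 0 ≤ c := by omega
      simp only [S, if_pos ha, if_pos hb, if_pos hc, mem_homogeneousSubmodule] at *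
      have e : c.toNat = a.toNat + b.toNat := by omega
      exact e ▸ hp.mul hq
    · simp only [S, if_neg hb, Submodule.mem_bot] at hq
      subst hq
      simp
  · simp only [S, if_neg ha, Submodule.mem_bot] at hp
    subst hp
    simp

/-- Multiplication of homogeneous polynomials, `S K a × S K b → S K c` whenever `c = a + b`. -/
def mulP {a b c : ℤ} (h : c = a + b) (f : S K a) (g : S K b) : S K c :=
  ⟨(f : MvPolynomial (Fin 2) K) * g, mul_mem_S K h f.2 g.2⟩

/-- Multiplication by a linear form `u ∈ U = S K 1`, as a linear map `S K b →ₗ S K c`,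
where `c = 1 + b`. -/
def mulLin {b c : ℤ} (h : c = 1 + b) (u : S K 1) : S K b →ₗ[K] S K c where
  toFun f := mulP K h u f
  map_add' f g := Subtype.ext (by simp [mulP, mul_add])
  map_smul' r f := Subtype.ext (by simp [mulP, mul_smul_comm])

/-- `V K m = U ⊗ S K m` where `U = S K 1`; it is `0` for `m < 0`. -/
abbrev V (m : ℤ) := (S K 1) ⊗[K] (S K m)

/-- Multiplication by the linear form `u ∈ U` on `V K b`: `u • (w ⊗ h) = w ⊗ (u*h)`. -/
def VMul {b c : ℤ} (h : c = 1 + b) (u : S K 1) : V K b →ₗ[K] V K c :=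
  LinearMap.lTensor (S K 1) (mulLin K h u)

section InstanceShortcuts

/-! Shortcut instances: Lean's instance search is very slow on iterated tensor products of
submodule coercions, so we register the instances for the shapes used below explicitly. -/

set_option synthInstance.maxHeartbeats 1000000

noncomputable instance iAG2 (a b : ℤ) : AddCommGroup ((S K a) ⊗[K] (S K b)) := by
  exact TensorProduct.addCommGroup

noncomputable instance iAG3 (a b c : ℤ) :
    AddCommGroup ((S K a) ⊗[K] ((S K b) ⊗[K] (S K c))) := by
  exact TensorProduct.addCommGroup

noncomputable instance iAG4 (a b c d : ℤ) :
    AddCommGroup (((S K a) ⊗[K] (S K b)) ⊗[K] ((S K c) ⊗[K] (S K d))) := by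
  exact TensorProduct.addCommGroup

noncomputable instance iAG5 (a b c d e : ℤ) :
    AddCommGroup ((S K a) ⊗[K] (((S K b) ⊗[K] (S K c)) ⊗[K] ((S K d) ⊗[K] (S K e)))) := by
  exact TensorProduct.addCommGroup

noncomputable instance iAG6 (a b c d e f : ℤ) :
    AddCommGroup ((S K a) ⊗[K]
      ((S K b) ⊗[K] (((S K c) ⊗[K] (S K d)) ⊗[K] ((S K e) ⊗[K] (S K f))))) := by
  exact TensorProduct.addCommGroup

noncomputable instance iAGW (m : ℤ) : AddCommGroup ↥(⋀[K]^2 (V K m)) := by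
  exact Submodule.addCommGroup _

noncomputable instance iAGSW (a m : ℤ) : AddCommGroup ((S K a) ⊗[K] ↥(⋀[K]^2 (V K m))) := by
  exact TensorProduct.addCommGroup

noncomputable instance iAGSSW (a b m : ℤ) :
    AddCommGroup ((S K a) ⊗[K] ((S K b) ⊗[K] ↥(⋀[K]^2 (V K m)))) := by
  exact TensorProduct.addCommGroup

end InstanceShortcuts

/-- The wedge `v ∧ w` of two elements of `V K m`, in the exterior square `⋀[K]^2 (V K m)`. -/
def wedge {m : ℤ} (v w : V K m) : ⋀[K]^2 (V K m) :=
  ⟨ExteriorAlgebra.ιMulti K 2 ![v, w], ExteriorAlgebra.ιMulti_range K 2 (Set.mem_range_self _)⟩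

/-- The coordinate functional on `S K m` w.r.t. the basis vector `s^(m-α) * t^α`
(the zero functional for out-of-range indices). -/
def coeffS (m : ℤ) (α : ℤ) : S K m →ₗ[K] K :=
  if 0 ≤ α ∧ α ≤ m then
    (lcoeff K (Finsupp.single (0 : Fin 2) (m - α).toNat + Finsupp.single (1 : Fin 2) α.toNat)) ∘ₗ
      (S K m).subtype
  else 0

/-- The tensor product of two linear functionals, as a functional on the tensor product. -/
def tmulFun {M N : Type} [AddCommGroup M] [Module K M] [AddCommGroup N] [Module K N]
    (φ : M →ₗ[K] K) (ψ : N →ₗ[K] K) : M ⊗[K] N →ₗ[K] K :=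
  (TensorProduct.lid K K).toLinearMap ∘ₗ TensorProduct.map φ ψ

/-- An index for the basis of `V K m`: `(false, μ)` stands for the unbarred basis vector
`x_μ = s ⊗ s^(m-μ)t^μ` and `(true, μ)` for the barred basis vector `x̄_μ = t ⊗ s^(m-μ)t^μ`. -/
abbrev VIdx := Bool × ℤ

/-- The coordinate functional on `V K m` at the basis vector indexed by `ι : VIdx`. -/
def coeffV (m : ℤ) (ι : VIdx) : V K m →ₗ[K] K :=
  tmulFun K (coeffS K 1 (if ι.1 then 1 else 0)) (coeffS K m ι.2)

/-- The alternating bilinear form `(v, w) ↦ φ(v)ψ(w) - φ(w)ψ(v)` built from two functionals. -/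
def altForm {M : Type} [AddCommGroup M] [Module K M] (φ ψ : M →ₗ[K] K) :
    M [⋀^Fin 2]→ₗ[K] K :=
  MultilinearMap.alternatization
    ((MultilinearMap.mkPiAlgebra K (Fin 2) K).compLinearMap ![φ, ψ])

/-- The functional on `⋀[K]^2 M` induced by the alternating form `altForm φ ψ`.  For
dual-basis functionals `φ`, `ψ` of two basis vectors `e`, `f` of `M` this is the coordinate
functional at the basis vector `e ∧ f` of the exterior square. -/
def coLam {M : Type} [AddCommGroup M] [Module K M] (φ ψ : M →ₗ[K] K) :
    ⋀[K]^2 M →ₗ[K] K :=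
  (ExteriorAlgebra.liftAlternating
    (fun i => match i with | 2 => altForm K φ ψ | _ => 0)) ∘ₗ (⋀[K]^2 M).subtype

/-- The determinant form on `U = S K 1` normalized by `d(s,t) = 1`. -/
def detU (w w' : S K 1) : K :=
  coeffS K 1 0 w * coeffS K 1 1 w' - coeffS K 1 1 w * coeffS K 1 0 w'

/-- The domain `S_{k-2} ⊗ S_{k-2} ⊗ V_{n-1} ⊗ V_{n-1}` of the map `Φ^∨`. -/
abbrev PhiDom (k n : ℤ) :=
  (S K (k-2)) ⊗[K] ((S K (k-2)) ⊗[K] (V K (n-1) ⊗[K] V K (n-1)))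

/-- The codomain `S_{k-1} ⊗ S_{k-1} ⊗ Λ²V_n` of the map `Φ^∨`. -/
abbrev PhiCod (k n : ℤ) :=
  (S K (k-1)) ⊗[K] ((S K (k-1)) ⊗[K] ↥(⋀[K]^2 (V K n)))

/-- The domain `S_{k-3} ⊗ S_{k-3} ⊗ V_{n-2} ⊗ V_{n-2}` of the map `ε'`. -/
abbrev EpsDom (k n : ℤ) :=
  (S K (k-3)) ⊗[K] ((S K (k-3)) ⊗[K] (V K (n-2) ⊗[K] V K (n-2)))

/-- `Φ` is the map `Φ^∨` of the paper:
`Φ^∨(g ⊗ g' ⊗ v ⊗ v') = sg ⊗ sg' ⊗ (tv ∧ tv') − sg ⊗ tg' ⊗ (tv ∧ sv')`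
`− tg ⊗ sg' ⊗ (sv ∧ tv') + tg ⊗ tg' ⊗ (sv ∧ sv')`. -/
def IsPhi (k n : ℤ) (Φ : PhiDom K k n →ₗ[K] PhiCod K k n) : Prop :=
  let sk : S K (k-2) → S K (k-1) := mulP K (by ring) (sU K)
  let tk : S K (k-2) → S K (k-1) := mulP K (by ring) (tU K)
  let sn : V K (n-1) →ₗ[K] V K n := VMul K (by ring) (sU K)
  let tn : V K (n-1) →ₗ[K] V K n := VMul K (by ring) (tU K)
  ∀ (g g' : S K (k-2)) (v v' : V K (n-1)),
    Φ (g ⊗ₜ[K] (g' ⊗ₜ[K] (v ⊗ₜ[K] v'))) =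
        (sk g) ⊗ₜ[K] ((sk g') ⊗ₜ[K] (wedge K (tn v) (tn v')))
      - (sk g) ⊗ₜ[K] ((tk g') ⊗ₜ[K] (wedge K (tn v) (sn v')))
      - (tk g) ⊗ₜ[K] ((sk g') ⊗ₜ[K] (wedge K (sn v) (tn v')))
      + (tk g) ⊗ₜ[K] ((tk g') ⊗ₜ[K] (wedge K (sn v) (sn v')))

/-- `ε` is the map `ε'` of the paper:
`ε'(f ⊗ f' ⊗ u ⊗ u') = sf ⊗ sf' ⊗ tu ⊗ tu' − sf ⊗ tf' ⊗ su ⊗ tu'`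
`− tf ⊗ sf' ⊗ tu ⊗ su' + tf ⊗ tf' ⊗ su ⊗ su'`. -/
def IsEps (k n : ℤ) (ε : EpsDom K k n →ₗ[K] PhiDom K k n) : Prop :=
  let sk : S K (k-3) → S K (k-2) := mulP K (by ring) (sU K)
  let tk : S K (k-3) → S K (k-2) := mulP K (by ring) (tU K)
  let sn : V K (n-2) →ₗ[K] V K (n-1) := VMul K (by ring) (sU K)
  let tn : V K (n-2) →ₗ[K] V K (n-1) := VMul K (by ring) (tU K)
  ∀ (f f' : S K (k-3)) (u u' : V K (n-2)),
    ε (f ⊗ₜ[K] (f' ⊗ₜ[K] (u ⊗ₜ[K] u'))) =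
        (sk f) ⊗ₜ[K] ((sk f') ⊗ₜ[K] ((tn u) ⊗ₜ[K] (tn u')))
      - (sk f) ⊗ₜ[K] ((tk f') ⊗ₜ[K] ((sn u) ⊗ₜ[K] (tn u')))
      - (tk f) ⊗ₜ[K] ((sk f') ⊗ₜ[K] ((tn u) ⊗ₜ[K] (sn u')))
      + (tk f) ⊗ₜ[K] ((tk f') ⊗ₜ[K] ((sn u) ⊗ₜ[K] (sn u')))

/-- The coordinate `c(α, β, ι, κ)` of an element `ξ` of `S_{k-2} ⊗ S_{k-2} ⊗ V_{n-1} ⊗ V_{n-1}`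
at the basis vector `f_α ⊗ f_β ⊗ z_ι ⊗ z_κ`; it is `0` for out-of-range indices. -/
def cCoord (k n : ℤ) (ξ : PhiDom K k n) (α β : ℤ) (ι κ : VIdx) : K :=
  tmulFun K (coeffS K (k-2) α)
    (tmulFun K (coeffS K (k-2) β)
      (tmulFun K (coeffV K (n-1) ι) (coeffV K (n-1) κ))) ξ

/-- The coordinate of an element `η` of `S_{k-1} ⊗ S_{k-1} ⊗ Λ²V_n` at the basis vector
`g_α ⊗ g_β ⊗ (z_ι ∧ z_κ)` of the codomain of `Φ^∨`. -/
def dCoord (k n : ℤ) (η : PhiCod K k n) (α β : ℤ) (ι κ : VIdx) : K :=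
  tmulFun K (coeffS K (k-1) α)
    (tmulFun K (coeffS K (k-1) β)
      (coLam K (coeffV K n ι) (coeffV K n κ))) η

/-- Index tuples `(α, β, ι, κ)` for the coordinates of elements of
`S_{k-2} ⊗ S_{k-2} ⊗ V_{n-1} ⊗ V_{n-1}`. -/
abbrev Idx := ℤ × ℤ × VIdx × VIdx

/-- The order on `V`-indices: unbarred indices are compared among themselves by size, barred
indices among themselves by size, and every unbarred index precedes every barred index. -/
def vIdxLt : VIdx → VIdx → Prop := Prod.Lex (· < ·) (· < ·)

/-- The lexicographical order on index tuples. -/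
def idxLt : Idx → Idx → Prop :=
  Prod.Lex (· < ·) (Prod.Lex (· < ·) (Prod.Lex (vIdxLt) (vIdxLt)))

/-- `t` is the lexicographically smallest index tuple at which `ξ` has a nonzero coordinate. -/
def IsFirstNonzero (k n : ℤ) (ξ : PhiDom K k n) (t : Idx) : Prop :=
  cCoord K k n ξ t.1 t.2.1 t.2.2.1 t.2.2.2 ≠ 0 ∧
  ∀ t' : Idx, idxLt t' t → cCoord K k n ξ t'.1 t'.2.1 t'.2.2.1 t'.2.2.2 = 0


/-- exponent vector `s^(m-i) t^i` -/
def dexp (m i : ℕ) : Fin 2 →₀ ℕ := Finsupp.single 0 (m - i) + Finsupp.single 1 i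

lemma mem_S_iff {m : ℤ} (hm : 0 ≤ m) (p : MvPolynomial (Fin 2) K) :
    p ∈ S K m ↔ p.IsHomogeneous m.toNat := by
  simp only [S, if_pos hm, mem_homogeneousSubmodule]

lemma dexp_degree {m i : ℕ} (h : i ≤ m) : (dexp m i).degree = m := by
  rw [Finsupp.degree_eq_sum]; simp [dexp, Fin.sum_univ_two]; omega

lemma dexp_eq {m : ℕ} {d : Fin 2 →₀ ℕ} (h : d.degree = m) : d 1 ≤ m ∧ d = dexp m (d 1) := by
  have h' : d 0 + d 1 = m := by
    rw [← h, Finsupp.degree_eq_sum]; simp [Fin.sum_univ_two]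
  refine ⟨by omega, ?_⟩
  ext j
  fin_cases j
  · simp [dexp]; omega
  · simp [dexp]

lemma dexp_inj {m i j : ℕ} (h : dexp m i = dexp m j) : i = j := by
  have := DFunLike.congr_fun h 1
  simpa [dexp] using this

/-- the monomial basis vector -/
def mono {m : ℤ} (hm : 0 ≤ m) (i : Fin (m.toNat + 1)) : S K m :=
  ⟨monomial (dexp m.toNat i) 1, (mem_S_iff K hm _).2
    (isHomogeneous_monomial _ (dexp_degree (by omega)))⟩

/-- coefficient functional -/
def cf (m : ℤ) (i : ℕ) : S K m →ₗ[K] K := (lcoeff K (dexp m.toNat i)) ∘ₗ (S K m).subtype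

lemma cf_apply (m : ℤ) (i : ℕ) (f : S K m) :
    cf K m i f = coeff (dexp m.toNat i) (f : MvPolynomial (Fin 2) K) := rfl

lemma cf_mono {m : ℤ} (hm : 0 ≤ m) (i : Fin (m.toNat + 1)) (j : ℕ) :
    cf K m j (mono K hm i) = if (i : ℕ) = j then 1 else 0 := by
  rw [cf_apply]
  simp only [mono, coeff_monomial]
  by_cases h : (i : ℕ) = j
  · simp [h]
  · rw [if_neg h, if_neg (fun h' => h (dexp_inj h'))]

lemma cf_ext {m : ℤ} (hm : 0 ≤ m) {f g : S K m}
    (h : ∀ i : Fin (m.toNat + 1), cf K m i f = cf K m i g) : f = g := by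
  apply Subtype.ext
  ext d
  by_cases hd : d.degree = m.toNat
  · obtain ⟨h1, h2⟩ := dexp_eq hd
    have := h ⟨d 1, by omega⟩
    rw [cf_apply, cf_apply] at this
    rw [h2]; exact this
  · rw [((mem_S_iff K hm _).1 f.2).coeff_eq_zero hd, ((mem_S_iff K hm _).1 g.2).coeff_eq_zero hd]

/-- coordinates -/
def eS {m : ℤ} (hm : 0 ≤ m) : S K m ≃ₗ[K] (Fin (m.toNat + 1) → K) :=
  LinearEquiv.ofBijective (LinearMap.pi fun i : Fin (m.toNat + 1) => cf K m i)
    ⟨fun f g h => cf_ext K hm fun i => congr_fun h i, fun c => by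
      refine ⟨∑ i, c i • mono K hm i, ?_⟩
      ext j
      simp [cf_mono, Fin.val_inj]⟩

/-- the monomial basis -/
def bS {m : ℤ} (hm : 0 ≤ m) : Module.Basis (Fin (m.toNat + 1)) K (S K m) :=
  Module.Basis.ofEquivFun (eS K hm)

lemma bS_repr {m : ℤ} (hm : 0 ≤ m) (f : S K m) (i) : (bS K hm).repr f i = cf K m i f := rfl

lemma bS_apply {m : ℤ} (hm : 0 ≤ m) (i) : bS K hm i = mono K hm i := by
  apply cf_ext K hm
  intro j
  rw [← bS_repr K hm, cf_mono, Module.Basis.repr_self, Finsupp.single_apply]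
  simp [Fin.val_inj]

lemma finrank_S {m : ℤ} (hm : 0 ≤ m) : Module.finrank K (S K m) = m.toNat + 1 := by
  rw [Module.finrank_eq_card_basis (bS K hm)]; simp

lemma finite_S {m : ℤ} (hm : 0 ≤ m) : Module.Finite K (S K m) :=
  Module.Finite.of_basis (bS K hm)

lemma mulLin_inj {b c : ℤ} (h : c = 1 + b) (u : S K 1)
    (hu : (u : MvPolynomial (Fin 2) K) ≠ 0) : Function.Injective (mulLin K h u) := by
  intro f g hfg
  have := congr_arg Subtype.val hfg
  exact Subtype.ext (mul_left_cancel₀ hu this)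

lemma VMul_inj {b c : ℤ} (h : c = 1 + b) (u : S K 1)
    (hu : (u : MvPolynomial (Fin 2) K) ≠ 0) : Function.Injective (VMul K h u) :=
  Module.Flat.lTensor_preserves_injective_linearMap _ (mulLin_inj K h u hu)

/-- contraction with coefficient functional -/
def ctr (m : ℤ) (i : ℕ) (W : Type) [AddCommGroup W] [Module K W] : (S K m) ⊗[K] W →ₗ[K] W :=
  (TensorProduct.lid K W).toLinearMap ∘ₗ LinearMap.rTensor W (cf K m i)

lemma ctr_tmul (m : ℤ) (i : ℕ) (W : Type) [AddCommGroup W] [Module K W] (f : S K m) (w : W) :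
    ctr K m i W (f ⊗ₜ[K] w) = cf K m i f • w := by simp [ctr]

lemma ctr_sep {m : ℤ} (hm : 0 ≤ m) (W : Type) [AddCommGroup W] [Module K W]
    (x : (S K m) ⊗[K] W) (h : ∀ i, i ≤ m.toNat → ctr K m i W x = 0) : x = 0 := by
  apply (TensorProduct.equivFinsuppOfBasisLeft (N := W) (bS K hm)).injective
  rw [map_zero]
  ext i
  rw [Finsupp.zero_apply, ← h i (by omega)]
  clear h
  induction x with
  | zero => simp
  | add a b ha hb => rw [map_add, map_add, Finsupp.add_apply, ha, hb]
  | tmul f w => 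
    rw [ctr_tmul, TensorProduct.equivFinsuppOfBasisLeft_apply_tmul_apply, bS_repr]

lemma cf_s {k : ℤ} (hk : 1 ≤ k) {i : ℕ} (hi : i ≤ (k-1).toNat) (f : S K (k-1)) (h : k = 1 + (k-1)) :
    cf K k i (mulP K h (sU K) f) = cf K (k-1) i f := by
  have : dexp k.toNat i = Finsupp.single 0 1 + dexp (k-1).toNat i := by
    ext j; fin_cases j
    · simp [dexp]; omega
    · simp [dexp]
  rw [cf_apply, cf_apply, this]
  exact coeff_X_mul _ _ _

lemma cf_t0 {k : ℤ} (f : S K (k-1)) (h : k = 1 + (k-1)) :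
    cf K k 0 (mulP K h (tU K) f) = 0 := by
  rw [cf_apply]
  simp only [mulP, tU]
  rw [coeff_X_mul']
  simp [dexp]

lemma cf_t {k : ℤ} (hk : 1 ≤ k) (i : ℕ) (f : S K (k-1)) (h : k = 1 + (k-1)) :
    cf K k (i+1) (mulP K h (tU K) f) = cf K (k-1) i f := by
  have : dexp k.toNat (i+1) = Finsupp.single 1 1 + dexp (k-1).toNat i := by
    ext j; fin_cases j
    · simp [dexp]; omega
    · simp [dexp]; omega
  rw [cf_apply, cf_apply, this]
  exact coeff_X_mul _ _ _

lemma mono_mul {k n : ℤ} (hk : 1 ≤ k) (hn : 1 ≤ n) (hkn : 0 ≤ k + n)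
    (i : Fin ((k+n).toNat + 1)) :
    ∃ (f : S K k) (g : S K n), mono K hkn i = mulP K rfl f g := by
  have hi := i.2
  refine ⟨mono K (by omega) ⟨min (i : ℕ) k.toNat, by omega⟩,
    mono K (by omega) ⟨(i : ℕ) - min (i : ℕ) k.toNat, by omega⟩, ?_⟩
  apply Subtype.ext
  simp only [mono, mulP, monomial_mul, mul_one]
  have : dexp (k+n).toNat i = dexp k.toNat (min (i : ℕ) k.toNat)
      + dexp n.toNat ((i : ℕ) - min (i : ℕ) k.toNat) := by
    ext j; fin_cases j
    · simp [dexp]; omega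
    · simp [dexp]
  rw [this]

/-- For all integers `k ≥ 1` and `n ≥ 1`, the sequence
`0 → S_{k−1} ⊗ V_{n−1} →β S_k ⊗ V_n →μ V_{k+n} → 0` is exact, where
`β(f ⊗ v) = sf ⊗ tv − tf ⊗ sv` and `μ(f ⊗ (w ⊗ g)) = w ⊗ (fg)`: `β` is injective,
`μ` is surjective, and `ker μ = im β`. -/
theorem statement1 (K : Type) [Field K] [CharZero K] (k n : ℤ) (hk : 1 ≤ k) (hn : 1 ≤ n)
    (β : (S K (k-1)) ⊗[K] V K (n-1) →ₗ[K] (S K k) ⊗[K] V K n)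
    (μ : (S K k) ⊗[K] V K n →ₗ[K] V K (k+n))
    (hβ : ∀ (f : S K (k-1)) (v : V K (n-1)),
      β (f ⊗ₜ[K] v) =
          (mulP K (show k = 1 + (k-1) by ring) (sU K) f) ⊗ₜ[K]
            (VMul K (show n = 1 + (n-1) by ring) (tU K) v)
        - (mulP K (show k = 1 + (k-1) by ring) (tU K) f) ⊗ₜ[K]
            (VMul K (show n = 1 + (n-1) by ring) (sU K) v))
    (hμ : ∀ (f : S K k) (w : S K 1) (g : S K n),
      μ (f ⊗ₜ[K] (w ⊗ₜ[K] g)) = w ⊗ₜ[K] (mulP K rfl f g)) :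
    Function.Injective β ∧ Function.Surjective μ ∧ LinearMap.ker μ = LinearMap.range β := by
  have hinj : Function.Injective β := by
    rw [injective_iff_map_eq_zero]
    intro x hx
    have h0 : ∀ y, ctr K k 0 (V K n) (β y) =
        VMul K (show n = 1 + (n-1) by ring) (tU K) (ctr K (k-1) 0 (V K (n-1)) y) := by
      intro y
      induction y with
      | zero => simp only [map_zero]
      | add a b ha hb => simp only [map_add, ha, hb]
      | tmul f v =>
        rw [hβ, map_sub, ctr_tmul, ctr_tmul, ctr_tmul, cf_s K hk (by omega), cf_t0, zero_smul,
          sub_zero, map_smul]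
    have h1 : ∀ i, i + 1 ≤ (k-1).toNat → ∀ y, ctr K k (i+1) (V K n) (β y) =
        VMul K (show n = 1 + (n-1) by ring) (tU K) (ctr K (k-1) (i+1) (V K (n-1)) y)
        - VMul K (show n = 1 + (n-1) by ring) (sU K) (ctr K (k-1) i (V K (n-1)) y) := by
      intro i hi y
      induction y with
      | zero => simp only [map_zero, sub_zero]
      | add a b ha hb => simp only [map_add, ha, hb]; abel
      | tmul f v =>
        rw [hβ, map_sub, ctr_tmul, ctr_tmul, ctr_tmul, ctr_tmul, cf_s K hk hi, cf_t K hk,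
          map_smul, map_smul]
    have ht := VMul_inj K (show n = 1 + (n-1) by ring) (tU K) (X_ne_zero 1)
    apply ctr_sep K (by omega)
    intro i
    induction i with
    | zero =>
      intro _
      apply ht
      rw [← h0, hx, map_zero, map_zero]
    | succ i ih =>
      intro hi
      have := h1 i hi x
      rw [ih (by omega), hx, map_zero, map_zero, sub_zero] at this
      apply ht
      rw [← this, map_zero]
  have hsurj : Function.Surjective μ := by
    have hkn : 0 ≤ k + n := by omega
    rw [← LinearMap.range_eq_top, eq_top_iff]
    intro y _
    induction y using TensorProduct.induction_on with
    | zero => exact Submodule.zero_mem _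
    | add a b ha hb => exact Submodule.add_mem _ (ha trivial) (hb trivial)
    | tmul w h =>
      rw [← (bS K hkn).sum_repr h, TensorProduct.tmul_sum]
      refine Submodule.sum_mem _ fun i _ => ?_
      rw [TensorProduct.tmul_smul]
      refine Submodule.smul_mem _ _ ?_
      obtain ⟨f, g, hfg⟩ := mono_mul K hk hn hkn i
      rw [bS_apply, hfg, ← hμ]
      exact ⟨_, rfl⟩
  refine ⟨hinj, hsurj, ?_⟩
  have hle : LinearMap.range β ≤ LinearMap.ker μ := by
    rintro _ ⟨y, rfl⟩
    rw [LinearMap.mem_ker]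
    induction y with
    | zero => simp only [map_zero]
    | add a b ha hb => rw [map_add, map_add, ha, hb, add_zero]
    | tmul f v =>
      induction v using TensorProduct.induction_on with
      | zero => rw [TensorProduct.tmul_zero, map_zero, map_zero]
      | add a b ha hb => rw [TensorProduct.tmul_add, map_add, map_add, ha, hb, add_zero]
      | tmul w g =>
        have e : ∀ u : S K 1, VMul K (show n = 1 + (n-1) by ring) u (w ⊗ₜ[K] g) =
          w ⊗ₜ[K] mulP K (show n = 1 + (n-1) by ring) u g := fun u => rfl
        rw [hβ, e, e, map_sub, hμ, hμ, sub_eq_zero]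
        congr 1
        apply Subtype.ext
        simp only [mulP]
        ring
  have := finite_S K (m := 1) (by omega)
  have := finite_S K (m := k) (by omega)
  have := finite_S K (m := n) (by omega)
  have := finite_S K (m := k-1) (by omega)
  have := finite_S K (m := n-1) (by omega)
  have := finite_S K (m := k+n) (by omega)
  symm
  apply Submodule.eq_of_le_of_finrank_eq hle
  have r1 := LinearMap.finrank_range_of_inj hinj
  have r2 := LinearMap.finrank_range_add_finrank_ker μ
  rw [LinearMap.range_eq_top.2 hsurj, finrank_top] at r2
  simp only [V, Module.finrank_tensorProduct] at r1 r2
  rw [finrank_S K (m := k) (by omega), finrank_S K (m := 1) (by omega),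
    finrank_S K (m := n) (by omega), finrank_S K (m := k + n) (by omega)] at r2
  rw [finrank_S K (m := k-1) (by omega), finrank_S K (m := 1) (by omega),
    finrank_S K (m := n-1) (by omega)] at r1
  rw [r1]
  obtain ⟨a, rfl⟩ : ∃ a : ℕ, k = a + 1 := ⟨(k-1).toNat, by omega⟩
  obtain ⟨b, rfl⟩ : ∃ b : ℕ, n = b + 1 := ⟨(n-1).toNat, by omega⟩
  have e1 : ((a:ℤ) + 1 + (b + 1)).toNat = a + b + 2 := by omega
  have e2 : ((a:ℤ) + 1).toNat = a + 1 := by omega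
  have e3 : ((b:ℤ) + 1).toNat = b + 1 := by omega
  have e4 : ((a:ℤ) + 1 - 1).toNat = a := by omega
  have e5 : ((b:ℤ) + 1 - 1).toNat = b := by omega
  rw [e1, e2, e3] at r2
  rw [e4, e5]
  have e6 : (1:ℤ).toNat = 1 := rfl
  rw [e6] at r2 ⊢
  nlinarith [r2]
end
end

section
/- For all integers k ≥ 1 and n ≥ 1, there is a unique linear map S_{k−1} ⊗ Λ²V_n → S_{2n+k−1} sending f ⊗ ((w ⊗ g) ∧ (w' ⊗ h)) to d(w,w')·fgh, where d is the determinant form on U with d(s,t) = 1; this map is surjective. Equivalently, its dual κ : S_{2n+k−1}^∨ → S_{k−1}^∨ ⊗ (Λ²V_n)^∨ is injective. -/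
open scoped TensorProduct
open MvPolynomial

noncomputable section

set_option maxHeartbeats 1000000
set_option synthInstance.maxHeartbeats 1000000

variable (K : Type) [Field K] [CharZero K]

set_option linter.unusedSectionVars false

/-- The characterizing property of the map `S_{k-1} ⊗ Λ²V_n → S_{2n+k-1}` of Statement 2:
it sends `f ⊗ ((w ⊗ g) ∧ (w' ⊗ h))` to `d(w,w') • (fgh)`. -/
def Stmt2Char (K : Type) [Field K] [CharZero K] (k n : ℤ)
    (φ : (S K (k-1)) ⊗[K] ↥(⋀[K]^2 (V K n)) →ₗ[K] S K (2*n+k-1)) : Prop :=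
  ∀ (f : S K (k-1)) (w w' : S K 1) (g h : S K n),
    φ (f ⊗ₜ[K] (wedge K (w ⊗ₜ[K] g) (w' ⊗ₜ[K] h))) =
      detU K w w' •
        mulP K (show 2*n+k-1 = (k-1) + (n+n) by ring) f (mulP K rfl g h)

section Stmt2Generic

variable {F : Type} [Field F] [CharZero F]

lemma gen_exists {U A P Q R : Type} [AddCommGroup U] [Module F U] [AddCommGroup A] [Module F A]
    [AddCommGroup P] [Module F P] [AddCommGroup Q] [Module F Q] [AddCommGroup R] [Module F R]
    (d : U →ₗ[F] U →ₗ[F] F) (hd : ∀ x y, d x y = - d y x)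
    (m : A →ₗ[F] A →ₗ[F] P) (hm : ∀ x y, m x y = m y x)
    (e : Q →ₗ[F] P →ₗ[F] R) :
    ∃ φ : Q ⊗[F] ↥(⋀[F]^2 (U ⊗[F] A)) →ₗ[F] R,
      ∀ f w w' g h, φ (f ⊗ₜ[F] (exteriorPower.ιMulti F 2 ![w ⊗ₜ[F] g, w' ⊗ₜ[F] h])) =
        d w w' • e f (m g h) := by
  let B0 : (U ⊗[F] A) ⊗[F] (U ⊗[F] A) →ₗ[F] P :=
    (TensorProduct.lid F P).toLinearMap ∘ₗ
      (TensorProduct.map (TensorProduct.lift d) (TensorProduct.lift m)) ∘ₗ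
      (TensorProduct.tensorTensorTensorComm F U A U A).toLinearMap
  have hB0 : ∀ w g w' h, B0 ((w ⊗ₜ[F] g) ⊗ₜ[F] (w' ⊗ₜ[F] h)) = d w w' • m g h := by
    intro w g w' h
    simp [B0]
  have hskew : ∀ x y, B0 (x ⊗ₜ[F] y) = - B0 (y ⊗ₜ[F] x) := by
    intro x y
    induction x using TensorProduct.induction_on with
    | zero => simp
    | add a b ha hb => rw [TensorProduct.add_tmul, TensorProduct.tmul_add, map_add, map_add, ha, hb, neg_add]
    | tmul w g =>
      induction y using TensorProduct.induction_on with
      | zero => simp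
      | add a b ha hb => rw [TensorProduct.add_tmul, TensorProduct.tmul_add, map_add, map_add, ha, hb, neg_add]
      | tmul w' h => rw [hB0, hB0, hd, hm g h, neg_smul]
  have halt : ∀ x, B0 (x ⊗ₜ[F] x) = 0 := by
    intro x
    have h1 := hskew x x
    have h2 : (2 : F) • B0 (x ⊗ₜ[F] x) = 0 := by
      rw [two_smul]
      nth_rewrite 1 [h1]
      exact neg_add_cancel _
    exact (smul_eq_zero.mp h2).resolve_left two_ne_zero
  let alt : (U ⊗[F] A) [⋀^Fin 2]→ₗ[F] P :=
    { toFun := fun v => B0 (v 0 ⊗ₜ[F] v 1)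
      map_update_add' := by
        intro _ v i x y
        fin_cases i
        · simp [TensorProduct.add_tmul]
        · simp [TensorProduct.tmul_add]
      map_update_smul' := by
        intro _ v i c x
        fin_cases i
        · have := map_smul B0 c (x ⊗ₜ[F] v 1)
          rw [TensorProduct.smul_tmul'] at this
          simpa only [Fin.zero_eta, Function.update_self, ne_eq, one_ne_zero, not_false_eq_true,
            Function.update_of_ne] using this
        · simp
      map_eq_zero_of_eq' := by
        intro v i j hv hij
        have : v 0 = v 1 := by
          fin_cases i <;> fin_cases j
          · exact absurd rfl hij
          · exact hv
          · exact hv.symm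
          · exact absurd rfl hij
        show B0 (v 0 ⊗ₜ[F] v 1) = 0
        rw [this]
        exact halt _ }
  refine ⟨TensorProduct.lift
    ((LinearMap.lcomp F R (exteriorPower.alternatingMapLinearEquiv alt)) ∘ₗ e), ?_⟩
  intro f w w' g h
  have : alt ![w ⊗ₜ[F] g, w' ⊗ₜ[F] h] = d w w' • m g h := hB0 w g w' h
  simp [exteriorPower.alternatingMapLinearEquiv_apply_ιMulti, this]

lemma gen_unique {U A Q R : Type} [AddCommGroup U] [Module F U] [AddCommGroup A] [Module F A]
    [AddCommGroup Q] [Module F Q] [AddCommGroup R] [Module F R]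
    (φ ψ : Q ⊗[F] ↥(⋀[F]^2 (U ⊗[F] A)) →ₗ[F] R)
    (H : ∀ f w w' g h, φ (f ⊗ₜ[F] (exteriorPower.ιMulti F 2 ![w ⊗ₜ[F] g, w' ⊗ₜ[F] h])) =
        ψ (f ⊗ₜ[F] (exteriorPower.ιMulti F 2 ![w ⊗ₜ[F] g, w' ⊗ₜ[F] h]))) : φ = ψ := by
  have key : ∀ f (x y : U ⊗[F] A), φ (f ⊗ₜ[F] (exteriorPower.ιMulti F 2 ![x, y])) =
        ψ (f ⊗ₜ[F] (exteriorPower.ιMulti F 2 ![x, y])) := by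
    intro f x y
    let L : (Q ⊗[F] ↥(⋀[F]^2 (U ⊗[F] A)) →ₗ[F] R) → MultilinearMap F (fun _ : Fin 2 => U ⊗[F] A) R :=
      fun χ => (χ ∘ₗ TensorProduct.mk F Q _ f).compMultilinearMap
        (exteriorPower.ιMulti F 2).toMultilinearMap
    have hL : ∀ χ v, L χ v = χ (f ⊗ₜ[F] (exteriorPower.ιMulti F 2 v)) := fun _ _ => rfl
    have addl : ∀ χ (a b y), L χ ![a + b, y] = L χ ![a, y] + L χ ![b, y] := by
      intro χ a b y
      have e : ∀ z, Function.update ![a, y] 0 z = ![z, y] := by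
        intro z; ext i; fin_cases i <;> rfl
      have := (L χ).map_update_add ![a, y] 0 a b
      rwa [e, e, e] at this
    have addr : ∀ χ (a b x), L χ ![x, a + b] = L χ ![x, a] + L χ ![x, b] := by
      intro χ a b x
      have e : ∀ z, Function.update ![x, a] 1 z = ![x, z] := by
        intro z; ext i; fin_cases i <;> rfl
      have := (L χ).map_update_add ![x, a] 1 a b
      rwa [e, e, e] at this
    have zl : ∀ χ (y), L χ ![0, y] = 0 := fun χ y => (L χ).map_coord_zero 0 rfl
    have zr : ∀ χ (y), L χ ![y, 0] = 0 := fun χ y => (L χ).map_coord_zero 1 rfl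
    rw [← hL, ← hL]
    induction x using TensorProduct.induction_on with
    | zero => rw [zl, zl]
    | add a b ha hb => rw [addl, addl, ha, hb]
    | tmul w g =>
      induction y using TensorProduct.induction_on with
      | zero => rw [zr, zr]
      | add a b ha hb => rw [addr, addr, ha, hb]
      | tmul w' h => exact H f w w' g h
  apply TensorProduct.ext
  ext1 f
  apply exteriorPower.linearMap_ext
  ext v
  have hv : v = ![v 0, v 1] := by
    ext i; fin_cases i <;> rfl
  rw [hv]
  exact key f _ _

end Stmt2Generic

lemma split_exponent (d : Fin 2 →₀ ℕ) (a b : ℕ) (h : d.degree = a + b) :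
    ∃ d1 d2 : Fin 2 →₀ ℕ, d = d1 + d2 ∧ d1.degree = a ∧ d2.degree = b := by
  have h' : d 0 + d 1 = a + b := by
    rw [← h, Finsupp.degree_eq_sum, Fin.sum_univ_two]
  refine ⟨Finsupp.single 0 (min (d 0) a) + Finsupp.single 1 (a - min (d 0) a),
    Finsupp.single 0 (d 0 - min (d 0) a) + Finsupp.single 1 (d 1 - (a - min (d 0) a)), ?_, ?_, ?_⟩
  · ext i
    fin_cases i
    · simp
    · simp; omega
  · rw [map_add, Finsupp.degree_single, Finsupp.degree_single]; omega
  · rw [map_add, Finsupp.degree_single, Finsupp.degree_single]; omega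

/-- The determinant form on `U`, bundled as a bilinear map. -/
def detLin : S K 1 →ₗ[K] S K 1 →ₗ[K] K :=
  LinearMap.mk₂ K (detU K)
    (by intro a b c; simp only [detU, map_add]; ring)
    (by intro a b c; simp only [detU, map_smul, smul_eq_mul]; ring)
    (by intro a b c; simp only [detU, map_add]; ring)
    (by intro a b c; simp only [detU, map_smul, smul_eq_mul]; ring)

/-- Multiplication of homogeneous polynomials, bundled as a bilinear map. -/
def mulPLin {a b c : ℤ} (h : c = a + b) : S K a →ₗ[K] S K b →ₗ[K] S K c :=
  LinearMap.mk₂ K (mulP K h)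
    (fun x y z => Subtype.ext (by simp [mulP, add_mul]))
    (fun r x y => Subtype.ext (by simp [mulP]))
    (fun x y z => Subtype.ext (by simp [mulP, mul_add]))
    (fun r x y => Subtype.ext (by simp [mulP]))

lemma detU_st : detU K (sU K) (tU K) = 1 := by
  simp [detU, coeffS, sU, tU, lcoeff, coeff_X, Finsupp.single_eq_single_iff]

lemma stmt2_surj (k n : ℤ) (hk : 1 ≤ k) (hn : 1 ≤ n)
    (φ : (S K (k-1)) ⊗[K] ↥(⋀[K]^2 (V K n)) →ₗ[K] S K (2*n+k-1))
    (hφ : Stmt2Char K k n φ) : Function.Surjective φ := by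
  have mono : ∀ (d : Fin 2 →₀ ℕ) (c : K), d.degree = (2*n+k-1).toNat →
      ∃ x, (φ x : MvPolynomial (Fin 2) K) = monomial d c := by
    intro d c hd
    obtain ⟨d1, d', rfl, h1, h'⟩ := split_exponent d (k-1).toNat (n.toNat + n.toNat) (by omega)
    obtain ⟨d2, d3, rfl, h2, h3⟩ := split_exponent d' n.toNat n.toNat h'
    refine ⟨(⟨monomial d1 c, (mem_S_iff K (by omega) _).2 (isHomogeneous_monomial _ h1)⟩ : S K (k-1))
      ⊗ₜ[K] wedge K
        (sU K ⊗ₜ[K] (⟨monomial d2 1, (mem_S_iff K (by omega) _).2 (isHomogeneous_monomial _ h2)⟩ : S K n))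
        (tU K ⊗ₜ[K] (⟨monomial d3 1, (mem_S_iff K (by omega) _).2 (isHomogeneous_monomial _ h3)⟩ : S K n)), ?_⟩
    rw [hφ, detU_st, one_smul]
    simp [mulP, monomial_mul]
  rintro ⟨p, hp⟩
  have hp' := (mem_S_iff K (by omega) _).1 hp
  have : ∀ d ∈ p.support, ∃ x, (φ x : MvPolynomial (Fin 2) K) = monomial d (coeff d p) := by
    intro d hd
    exact mono d _ (hp'.degree_eq_sum_deg_support hd).symm
  choose! x hx using this
  refine ⟨∑ d ∈ p.support, x d, Subtype.ext ?_⟩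
  rw [map_sum, AddSubmonoidClass.coe_finsetSum]
  exact (Finset.sum_congr rfl hx).trans p.as_sum.symm

/-- For all integers `k ≥ 1` and `n ≥ 1`, there is a unique linear map
`S_{k−1} ⊗ Λ²V_n → S_{2n+k−1}` sending `f ⊗ ((w ⊗ g) ∧ (w' ⊗ h))` to `d(w,w')·fgh`,
where `d` is the determinant form on `U` with `d(s,t) = 1`; moreover this map is
surjective (equivalently, its dual `κ` is injective). -/
theorem statement2 (K : Type) [Field K] [CharZero K] (k n : ℤ) (hk : 1 ≤ k) (hn : 1 ≤ n) :
    (∃! φ : (S K (k-1)) ⊗[K] ↥(⋀[K]^2 (V K n)) →ₗ[K] S K (2*n+k-1), Stmt2Char K k n φ) ∧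
    (∀ φ : (S K (k-1)) ⊗[K] ↥(⋀[K]^2 (V K n)) →ₗ[K] S K (2*n+k-1),
      Stmt2Char K k n φ → Function.Surjective φ) := by
  refine ⟨?_, fun φ hφ => stmt2_surj K k n hk hn φ hφ⟩
  obtain ⟨φ, hφ⟩ := gen_exists (detLin K) (fun x y => by
      simp only [detLin, detU, LinearMap.mk₂_apply]; ring)
    (mulPLin K (rfl : n + n = n + n))
    (fun x y => Subtype.ext (by simp [mulPLin, mulP, mul_comm]))
    (mulPLin K (show 2*n+k-1 = (k-1) + (n+n) by ring))
  refine ⟨φ, fun f w w' g h => hφ f w w' g h, ?_⟩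
  intro ψ hψ
  exact gen_unique ψ φ fun f w w' g h => (hψ f w w' g h).trans (hφ f w w' g h).symm
end
end

section
/- For all integers k ≥ 1 and n ≥ 1, and for all f, f' ∈ S_{k−3} and u, u' ∈ V_{n−2}, one has Φ^∨( ε'(f ⊗ f' ⊗ u ⊗ u') + ε'(f ⊗ f' ⊗ u' ⊗ u) ) = 0. In other words, the image under ε' of S_{k−3} ⊗ S_{k−3} ⊗ Sym²(V_{n−2}) is contained in the kernel of Φ^∨, where Sym²(V_{n−2}) ⊆ V_{n−2} ⊗ V_{n−2} is the subspace of symmetric tensors. -/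
open scoped TensorProduct
open MvPolynomial

noncomputable section

set_option maxHeartbeats 1000000
set_option synthInstance.maxHeartbeats 1000000

variable (K : Type) [Field K] [CharZero K]

set_option linter.unusedSectionVars false

lemma mulP_comm_aux {a b c : ℤ} (h : b = 1 + a) (h' : c = 1 + b) (x y : S K 1) (f : S K a) :
    mulP K h' x (mulP K h y f) = mulP K h' y (mulP K h x f) := by
  apply Subtype.ext
  simp only [mulP]
  ring

lemma VMul_comm_aux {a b c : ℤ} (h : b = 1 + a) (h' : c = 1 + b) (x y : S K 1) (v : V K a) :
    VMul K h' x (VMul K h y v) = VMul K h' y (VMul K h x v) := by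
  have e : (mulLin K h' x) ∘ₗ (mulLin K h y) = (mulLin K h' y) ∘ₗ (mulLin K h x) := by
    ext1 f
    exact mulP_comm_aux K h h' x y f
  simp only [VMul]
  rw [← LinearMap.lTensor_comp_apply, ← LinearMap.lTensor_comp_apply, e]

lemma wedge_swap_aux {m : ℤ} (v w : V K m) : wedge K v w = -wedge K w v := by
  apply Subtype.ext
  have h := (ExteriorAlgebra.ιMulti K 2 (M := V K m)).map_swap ![w, v]
    (i := 0) (j := 1) (by decide)
  have e : (![w, v] ∘ (Equiv.swap (0 : Fin 2) 1)) = ![v, w] := by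
    funext i
    fin_cases i <;> simp
  rw [e] at h
  exact h

/-- For all integers `k ≥ 1` and `n ≥ 1`, and all `f, f' ∈ S_{k−3}`,
`u, u' ∈ V_{n−2}`, one has `Φ^∨(ε'(f ⊗ f' ⊗ u ⊗ u') + ε'(f ⊗ f' ⊗ u' ⊗ u)) = 0`; that is,
the image under `ε'` of `S_{k−3} ⊗ S_{k−3} ⊗ Sym²(V_{n−2})` is contained in `ker Φ^∨`. -/
theorem statement4 (K : Type) [Field K] [CharZero K] (k n : ℤ) (hk : 1 ≤ k) (hn : 1 ≤ n)
    (Φ : PhiDom K k n →ₗ[K] PhiCod K k n) (hΦ : IsPhi K k n Φ)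
    (ε : EpsDom K k n →ₗ[K] PhiDom K k n) (hε : IsEps K k n ε) :
    ∀ (f f' : S K (k-3)) (u u' : V K (n-2)),
      Φ (ε (f ⊗ₜ[K] (f' ⊗ₜ[K] (u ⊗ₜ[K] u'))) + ε (f ⊗ₜ[K] (f' ⊗ₜ[K] (u' ⊗ₜ[K] u)))) = 0 := by
  intro f f' u u'
  rw [hε f f' u u', hε f f' u' u]
  simp only [map_add, map_sub]
  simp only [hΦ _ _ _ _]
  simp only [mulP_comm_aux K _ _ (tU K) (sU K), VMul_comm_aux K _ _ (tU K) (sU K)]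
  have hw : ∀ (h : n - 1 = 1 + (n-2)) (h' : n = 1 + (n-1)) (x y z w : S K 1),
      wedge K (VMul K h' x (VMul K h y u')) (VMul K h' z (VMul K h w u)) =
      -wedge K (VMul K h' z (VMul K h w u)) (VMul K h' x (VMul K h y u')) :=
    fun _ _ _ _ _ _ => wedge_swap_aux K _ _
  simp only [hw, TensorProduct.tmul_neg]
  abel
end
end

section
/- For all integers k ≥ 1 and n ≥ 1, the kernel of Φ^∨ equals the image under ε' of the subspace S_{k−3} ⊗ S_{k−3} ⊗ Sym²(V_{n−2}), where Sym²(V_{n−2}) ⊆ V_{n−2} ⊗ V_{n−2} is the subspace of symmetric tensors (spanned by the elements u ⊗ u' + u' ⊗ u). Since ε' is injective, the kernel of Φ^∨ is thereby isomorphic to S_{k−3} ⊗ S_{k−3} ⊗ S²(V_{n−2}). -/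
open scoped TensorProduct
open MvPolynomial

noncomputable section

set_option maxHeartbeats 1000000
set_option synthInstance.maxHeartbeats 1000000

variable (K : Type) [Field K] [CharZero K]

set_option linter.unusedSectionVars false

abbrev R2 := MvPolynomial (Fin 2) K
abbrev QQ := (R2 K) ⊗[K] (R2 K)
set_option maxSynthPendingDepth 6
abbrev TT := (R2 K) ⊗[K] ((R2 K) ⊗[K] ((QQ K) ⊗[K] (QQ K)))
abbrev II := Fin 2 ⊕ (Fin 2 ⊕ ((Fin 2 ⊕ Fin 2) ⊕ (Fin 2 ⊕ Fin 2)))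

def psiQ : QQ K ≃ₐ[K] MvPolynomial (Fin 2 ⊕ Fin 2) K := tensorEquivSum K (Fin 2) (Fin 2) K

def psiT : TT K ≃ₐ[K] MvPolynomial II K :=
  (Algebra.TensorProduct.congr AlgEquiv.refl
    ((Algebra.TensorProduct.congr AlgEquiv.refl
      ((Algebra.TensorProduct.congr (psiQ K) (psiQ K)).trans (tensorEquivSum K _ _ K))).trans
        (tensorEquivSum K _ _ K))).trans (tensorEquivSum K _ _ K)

def eA (i : Fin 2) : TT K := X i ⊗ₜ 1
def eB (i : Fin 2) : TT K := 1 ⊗ₜ (X i ⊗ₜ 1)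
def eX (i : Fin 2) : TT K := 1 ⊗ₜ (1 ⊗ₜ ((1 ⊗ₜ X i) ⊗ₜ 1))
def eY (i : Fin 2) : TT K := 1 ⊗ₜ (1 ⊗ₜ (1 ⊗ₜ (1 ⊗ₜ X i)))

lemma psi_eA (i) : psiT K (eA K i) = X (Sum.inl i) := by
  simp [psiT, eA, psiQ]
lemma psi_eB (i) : psiT K (eB K i) = X (Sum.inr (Sum.inl i)) := by
  simp [psiT, eB, psiQ]
lemma psi_eX (i) : psiT K (eX K i) = X (Sum.inr (Sum.inr (Sum.inl (Sum.inr i)))) := by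
  simp [psiT, eX, psiQ]
lemma psi_eY (i) : psiT K (eY K i) = X (Sum.inr (Sum.inr (Sum.inr (Sum.inr i)))) := by
  simp [psiT, eY, psiQ]

def sig : TT K ≃ₐ[K] TT K :=
  Algebra.TensorProduct.congr AlgEquiv.refl
    (Algebra.TensorProduct.congr AlgEquiv.refl (Algebra.TensorProduct.comm K (QQ K) (QQ K)))

def eF : TT K := (eA K 0 * eX K 1 - eA K 1 * eX K 0) * (eB K 0 * eY K 1 - eB K 1 * eY K 0)
def eE : TT K := (eA K 0 * eY K 1 - eA K 1 * eY K 0) * (eB K 0 * eX K 1 - eB K 1 * eX K 0)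

lemma sig_eF : sig K (eF K) = eE K := by
  have h1 (i) : sig K (eA K i) = eA K i := by simp [sig, eA]
  have h2 (i) : sig K (eB K i) = eB K i := by simp [sig, eB]
  have h3 (i) : sig K (eX K i) = eY K i := by simp [sig, eX, eY]
  have h4 (i) : sig K (eY K i) = eX K i := by simp [sig, eX, eY]
  simp only [eF, eE, map_mul, map_sub, h1, h2, h3, h4]

lemma sig_tmul (f g : R2 K) (q q' : QQ K) :
    sig K (f ⊗ₜ (g ⊗ₜ (q ⊗ₜ q'))) = f ⊗ₜ (g ⊗ₜ (q' ⊗ₜ q)) := by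
  simp [sig]

lemma sig_sig (z : TT K) : sig K (sig K z) = z := by
  have : ((sig K).trans (sig K)).toAlgHom = AlgHom.id K _ := by
    simp only [sig]
    ext <;> simp
  exact DFunLike.congr_fun this z

lemma det_irred {ι : Type} [DecidableEq ι] (p q r s : ι) (h1 : p ≠ q) (h2 : p ≠ r) (h3 : p ≠ s)
    (h4 : q ≠ r) (h5 : q ≠ s) :
    Prime (X p * X q - X r * X s : MvPolynomial ι K) := by
  rw [← irreducible_iff_prime, sub_eq_add_neg]
  apply irreducible_mul_X_add
  · exact X_ne_zero _
  · simp [vars_X, h1.symm]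
  · rw [vars_neg]
    intro h
    have := vars_mul _ _ h
    simp [vars_X, h4, h5] at this
  · rw [IsRelPrime.neg_right_iff]
    have hp : Prime (X p : MvPolynomial ι K) := X_prime
    rw [hp.irreducible.isRelPrime_iff_not_dvd]
    intro h
    rcases hp.dvd_or_dvd h with h | h
    · exact h2 (by simpa [X_dvd_X] using h)
    · exact h3 (by simpa [X_dvd_X] using h)

lemma det_not_dvd {ι : Type} [DecidableEq ι] (p q r s p' q' r' s' : ι) (v : ι → K)
    (h1 : v p * v q - v r * v s = 0) (h2 : v p' * v q' - v r' * v s' ≠ 0) :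
    ¬ (X p * X q - X r * X s : MvPolynomial ι K) ∣ (X p' * X q' - X r' * X s') := by
  rintro ⟨c, hc⟩
  have := congrArg (MvPolynomial.eval v) hc
  simp [h1] at this
  exact h2 this

lemma key_dvd (z w : TT K) (h : eF K * z = eE K * w) : eE K ∣ z := by
  rw [← map_dvd_iff (psiT K)]
  have h' := congrArg (psiT K) h
  simp only [eF, eE, map_mul, map_sub, psi_eA, psi_eB, psi_eX, psi_eY] at h' ⊢
  generalize psiT K z = z at *
  generalize psiT K w = w at *
  set ax : MvPolynomial II K := X (Sum.inl 0) * X (Sum.inr (Sum.inr (Sum.inl (Sum.inr 1)))) - X (Sum.inl 1) * X (Sum.inr (Sum.inr (Sum.inl (Sum.inr 0)))) with hax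
  set byy : MvPolynomial II K := X (Sum.inr (Sum.inl 0)) * X (Sum.inr (Sum.inr (Sum.inr (Sum.inr 1)))) - X (Sum.inr (Sum.inl 1)) * X (Sum.inr (Sum.inr (Sum.inr (Sum.inr 0)))) with hby
  set ay : MvPolynomial II K := X (Sum.inl 0) * X (Sum.inr (Sum.inr (Sum.inr (Sum.inr 1)))) - X (Sum.inl 1) * X (Sum.inr (Sum.inr (Sum.inr (Sum.inr 0)))) with hay
  set bx : MvPolynomial II K := X (Sum.inr (Sum.inl 0)) * X (Sum.inr (Sum.inr (Sum.inl (Sum.inr 1)))) - X (Sum.inr (Sum.inl 1)) * X (Sum.inr (Sum.inr (Sum.inl (Sum.inr 0)))) with hbx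
  have pay : Prime ay := by apply det_irred <;> simp
  have pbx : Prime bx := by apply det_irred <;> simp
  have n1 : ¬ ay ∣ ax := by
    apply det_not_dvd K _ _ _ _ _ _ _ _
      (Sum.elim ![1, 0] (Sum.elim ![0, 0] (Sum.elim (Sum.elim ![0, 0] ![0, 1]) (Sum.elim ![0, 0] ![0, 0]))))
      <;> simp
  have n2 : ¬ ay ∣ byy := by
    apply det_not_dvd K _ _ _ _ _ _ _ _
      (Sum.elim ![0, 0] (Sum.elim ![1, 0] (Sum.elim (Sum.elim ![0, 0] ![0, 0]) (Sum.elim ![0, 0] ![0, 1]))))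
      <;> simp
  have n3 : ¬ bx ∣ ax := by
    apply det_not_dvd K _ _ _ _ _ _ _ _
      (Sum.elim ![1, 0] (Sum.elim ![0, 0] (Sum.elim (Sum.elim ![0, 0] ![0, 1]) (Sum.elim ![0, 0] ![0, 0]))))
      <;> simp
  have n4 : ¬ bx ∣ byy := by
    apply det_not_dvd K _ _ _ _ _ _ _ _
      (Sum.elim ![0, 0] (Sum.elim ![1, 0] (Sum.elim (Sum.elim ![0, 0] ![0, 0]) (Sum.elim ![0, 0] ![0, 1]))))
      <;> simp
  have d1 : ay ∣ z := by
    have : ay ∣ ax * byy * z := ⟨bx * w, by rw [h']; ring⟩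
    rcases pay.dvd_or_dvd this with h | h
    · rcases pay.dvd_or_dvd h with h | h
      · exact absurd h n1
      · exact absurd h n2
    · exact h
  obtain ⟨z1, rfl⟩ := d1
  have d2 : bx ∣ z1 := by
    have e : ax * byy * z1 = bx * w := by
      apply mul_left_cancel₀ pay.ne_zero
      linear_combination h'
    have : bx ∣ ax * byy * z1 := ⟨w, e⟩
    rcases pbx.dvd_or_dvd this with h | h
    · rcases pbx.dvd_or_dvd h with h | h
      · exact absurd h n3
      · exact absurd h n4
    · exact h
  exact mul_dvd_mul_left _ d2

lemma cancelEF (z : TT K) (h : eF K * (eE K * z) = 0) : z = 0 := by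
  have h' := congrArg (psiT K) h
  have : psiT K z = 0 := by
    simp only [eF, eE, map_mul, map_sub, psi_eA, psi_eB, psi_eX, psi_eY, map_zero, mul_eq_zero] at h'
    rcases h' with (h | h) | (h | h) | h
    all_goals first | exact h | exact absurd h (Prime.ne_zero (by apply det_irred <;> simp))
  simpa using this

lemma homComp_X_mul (i : Fin 2) (m : ℕ) (p : R2 K) :
    homogeneousComponent (m + 1) (X i * p) = X i * homogeneousComponent m p := by
  ext d
  rw [coeff_homogeneousComponent, coeff_X_mul', coeff_X_mul', coeff_homogeneousComponent]
  by_cases h : i ∈ d.support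
  · have h1 : Finsupp.single i 1 ≤ d := by
      rw [Finsupp.single_le_iff]
      exact Nat.one_le_iff_ne_zero.mpr (Finsupp.mem_support_iff.mp h)
    obtain ⟨e, rfl⟩ := exists_add_of_le h1
    simp only [h, if_true, add_tsub_cancel_left]
    have : (Finsupp.single i 1 + e).degree = 1 + e.degree := by
      rw [map_add]; simp
    rw [this]
    congr 1
    simp only [eq_iff_iff]
    omega
  · simp [h]

lemma homComp_zero_X_mul (i : Fin 2) (p : R2 K) :
    homogeneousComponent 0 (X i * p) = 0 := by
  simp [coeff_X_mul']

/-- projection of a polynomial to its homogeneous component -/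
def rS (m : ℤ) : R2 K →ₗ[K] S K m :=
  LinearMap.codRestrict (S K m) (if 0 ≤ m then homogeneousComponent m.toNat else 0) (by
    intro c
    by_cases h : 0 ≤ m
    · simp only [S, h, if_true]
      exact homogeneousComponent_mem _ _
    · simp [h])

lemma rS_coe (m : ℤ) (p : R2 K) : ((rS K m p : S K m) : R2 K) =
    if 0 ≤ m then homogeneousComponent m.toNat p else 0 := by
  simp only [rS, LinearMap.codRestrict_apply]
  split_ifs <;> rfl

lemma rS_sub (m : ℤ) (f : S K m) : rS K m f.1 = f := by
  apply Subtype.ext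
  rw [rS_coe]
  obtain ⟨f, hf⟩ := f
  by_cases h : 0 ≤ m
  · simp only [S, h, if_true] at hf ⊢
    exact homogeneousComponent_eq_self hf
  · simp only [S, h, if_false, Submodule.mem_bot] at hf ⊢
    exact hf.symm

lemma rS_mul {b c : ℤ} (h : c = 1 + b) (u : S K 1) (i : Fin 2) (hu : u.1 = X i) (p : R2 K) :
    rS K c (X i * p) = mulP K h u (rS K b p) := by
  apply Subtype.ext
  simp only [mulP, rS_coe, hu]
  by_cases hb : 0 ≤ b
  · have hc : 0 ≤ c := by omega
    have e : c.toNat = b.toNat + 1 := by omega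
    simp only [hb, hc, if_true, e, homComp_X_mul]
  · by_cases hc : 0 ≤ c
    · have e : c.toNat = 0 := by omega
      simp only [hb, hc, if_true, if_false, e, homComp_zero_X_mul, mul_zero]
    · simp [hb, hc]

def jV (m : ℤ) : V K m →ₗ[K] QQ K := TensorProduct.map (S K 1).subtype (S K m).subtype
def rV (m : ℤ) : QQ K →ₗ[K] V K m := TensorProduct.map (rS K 1) (rS K m)

lemma rV_jV (m : ℤ) (v : V K m) : rV K m (jV K m v) = v := by
  induction v using TensorProduct.induction_on with
  | zero => simp
  | add x y hx hy => rw [map_add, map_add, hx, hy]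
  | tmul f g => simp [rV, jV, rS_sub]

lemma jV_mul {b c : ℤ} (h : c = 1 + b) (u : S K 1) (i : Fin 2) (hu : u.1 = X i) (v : V K b) :
    jV K c (VMul K h u v) = (1 ⊗ₜ X i) * jV K b v := by
  induction v using TensorProduct.induction_on with
  | zero => simp
  | add x y hx hy => rw [map_add, map_add, hx, hy, map_add, mul_add]
  | tmul f g => simp [jV, VMul, mulLin, mulP, hu]

lemma rV_mul {b c : ℤ} (h : c = 1 + b) (u : S K 1) (i : Fin 2) (hu : u.1 = X i) (q : QQ K) :
    rV K c ((1 ⊗ₜ X i) * q) = VMul K h u (rV K b q) := by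
  induction q using TensorProduct.induction_on with
  | zero => simp
  | add x y hx hy => rw [mul_add, map_add, hx, hy, map_add, map_add]
  | tmul f g => simp [rV, VMul, mulLin, rS_mul K h u i hu]

def jT (a m : ℤ) : (S K a) ⊗[K] ((S K a) ⊗[K] (V K m ⊗[K] V K m)) →ₗ[K] TT K :=
  TensorProduct.map (S K a).subtype (TensorProduct.map (S K a).subtype
    (TensorProduct.map (jV K m) (jV K m)))
def rT (a m : ℤ) : TT K →ₗ[K] (S K a) ⊗[K] ((S K a) ⊗[K] (V K m ⊗[K] V K m)) :=
  TensorProduct.map (rS K a) (TensorProduct.map (rS K a)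
    (TensorProduct.map (rV K m) (rV K m)))

lemma jT_tmul (a m : ℤ) (f g : S K a) (v w : V K m) :
    jT K a m (f ⊗ₜ (g ⊗ₜ (v ⊗ₜ w))) = f.1 ⊗ₜ (g.1 ⊗ₜ (jV K m v ⊗ₜ jV K m w)) := rfl
lemma rT_tmul (a m : ℤ) (f g : R2 K) (v w : QQ K) :
    rT K a m (f ⊗ₜ (g ⊗ₜ (v ⊗ₜ w))) = rS K a f ⊗ₜ (rS K a g ⊗ₜ (rV K m v ⊗ₜ rV K m w)) := rfl

lemma ind4 {A B C D : Type} [AddCommGroup A] [Module K A] [AddCommGroup B] [Module K B]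
    [AddCommGroup C] [Module K C] [AddCommGroup D] [Module K D]
    (P : A ⊗[K] (B ⊗[K] (C ⊗[K] D)) → Prop) (h0 : P 0)
    (hadd : ∀ x y, P x → P y → P (x + y))
    (h : ∀ a b c d, P (a ⊗ₜ (b ⊗ₜ (c ⊗ₜ d)))) (z) : P z := by
  induction z with
  | zero => exact h0
  | add x y hx hy => exact hadd _ _ hx hy
  | tmul a y =>
    induction y with
    | zero => simpa using h0
    | add x y hx hy => rw [TensorProduct.tmul_add]; exact hadd _ _ hx hy
    | tmul b y =>
      induction y with
      | zero => simpa using h0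
      | add x y hx hy => rw [TensorProduct.tmul_add, TensorProduct.tmul_add]; exact hadd _ _ hx hy
      | tmul c d => exact h _ _ _ _

lemma rT_jT (a m : ℤ) (z) : rT K a m (jT K a m z) = z := by
  induction z using ind4 with
  | h0 => rw [map_zero, map_zero]
  | hadd x y hx hy => rw [map_add, map_add, hx, hy]
  | h f g v w => rw [jT_tmul, rT_tmul, rS_sub, rS_sub, rV_jV, rV_jV]

lemma jT_inj (a m : ℤ) : Function.Injective (jT K a m) :=
  Function.LeftInverse.injective (rT_jT K a m)

lemma eE_mul (f g : R2 K) (v w : QQ K) : eE K * (f ⊗ₜ (g ⊗ₜ (v ⊗ₜ w))) =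
    (X 0 * f) ⊗ₜ ((X 0 * g) ⊗ₜ (((1 ⊗ₜ X 1) * v) ⊗ₜ ((1 ⊗ₜ X 1) * w)))
    - (X 0 * f) ⊗ₜ ((X 1 * g) ⊗ₜ (((1 ⊗ₜ X 0) * v) ⊗ₜ ((1 ⊗ₜ X 1) * w)))
    - (X 1 * f) ⊗ₜ ((X 0 * g) ⊗ₜ (((1 ⊗ₜ X 1) * v) ⊗ₜ ((1 ⊗ₜ X 0) * w)))
    + (X 1 * f) ⊗ₜ ((X 1 * g) ⊗ₜ (((1 ⊗ₜ X 0) * v) ⊗ₜ ((1 ⊗ₜ X 0) * w))) := by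
  simp only [eE, eA, eB, eX, eY, sub_mul, mul_sub, Algebra.TensorProduct.tmul_mul_tmul, one_mul, mul_one]
  abel

lemma eF_mul (f g : R2 K) (v w : QQ K) : eF K * (f ⊗ₜ (g ⊗ₜ (v ⊗ₜ w))) =
    (X 0 * f) ⊗ₜ ((X 0 * g) ⊗ₜ (((1 ⊗ₜ X 1) * v) ⊗ₜ ((1 ⊗ₜ X 1) * w)))
    - (X 0 * f) ⊗ₜ ((X 1 * g) ⊗ₜ (((1 ⊗ₜ X 1) * v) ⊗ₜ ((1 ⊗ₜ X 0) * w)))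
    - (X 1 * f) ⊗ₜ ((X 0 * g) ⊗ₜ (((1 ⊗ₜ X 0) * v) ⊗ₜ ((1 ⊗ₜ X 1) * w)))
    + (X 1 * f) ⊗ₜ ((X 1 * g) ⊗ₜ (((1 ⊗ₜ X 0) * v) ⊗ₜ ((1 ⊗ₜ X 0) * w))) := by
  simp only [eF, eA, eB, eX, eY, sub_mul, mul_sub, Algebra.TensorProduct.tmul_mul_tmul, one_mul, mul_one]
  abel

lemma sU_coe : (sU K).1 = X 0 := rfl
lemma tU_coe : (tU K).1 = X 1 := rfl
lemma mulP_coe {a b c : ℤ} (h : c = a + b) (f : S K a) (g : S K b) :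
    (mulP K h f g).1 = f.1 * g.1 := rfl

lemma rT_eE (k n : ℤ) (ε : EpsDom K k n →ₗ[K] PhiDom K k n) (hε : IsEps K k n ε) (z : TT K) :
    rT K (k-2) (n-1) (eE K * z) = ε (rT K (k-3) (n-2) z) := by
  induction z using ind4 with
  | h0 => rw [mul_zero, map_zero, map_zero, map_zero]
  | hadd x y hx hy => rw [mul_add, map_add, hx, hy, map_add, map_add]
  | h f g v w =>
    rw [eE_mul, rT_tmul, hε, map_add, map_sub, map_sub]
    simp only [rT_tmul]
    rw [rS_mul K (by ring : k - 2 = 1 + (k-3)) (sU K) 0 rfl,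
      rS_mul K (by ring : k - 2 = 1 + (k-3)) (sU K) 0 rfl,
      rS_mul K (by ring : k - 2 = 1 + (k-3)) (tU K) 1 rfl,
      rS_mul K (by ring : k - 2 = 1 + (k-3)) (tU K) 1 rfl,
      rV_mul K (by ring : n - 1 = 1 + (n-2)) (sU K) 0 rfl,
      rV_mul K (by ring : n - 1 = 1 + (n-2)) (sU K) 0 rfl,
      rV_mul K (by ring : n - 1 = 1 + (n-2)) (tU K) 1 rfl,
      rV_mul K (by ring : n - 1 = 1 + (n-2)) (tU K) 1 rfl]

lemma jT_eps (k n : ℤ) (ε : EpsDom K k n →ₗ[K] PhiDom K k n) (hε : IsEps K k n ε)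
    (z : EpsDom K k n) :
    jT K (k-2) (n-1) (ε z) = eE K * jT K (k-3) (n-2) z := by
  induction z using ind4 with
  | h0 => rw [map_zero, map_zero, map_zero, mul_zero]
  | hadd x y hx hy => rw [map_add, map_add, hx, hy, map_add, mul_add]
  | h f g v w =>
    rw [jT_tmul, eE_mul, hε, map_add, map_sub, map_sub]
    simp only [jT_tmul, mulP_coe, sU_coe, tU_coe, jV_mul K _ (sU K) 0 rfl, jV_mul K _ (tU K) 1 rfl]

lemma wedge_eq {m : ℤ} (v w : V K m) : wedge K v w = exteriorPower.ιMulti K 2 ![v, w] := rfl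

/-- `v ∧ w ↦ v ⊗ w - w ⊗ v`. -/
def altQ (m : ℤ) : V K m [⋀^Fin 2]→ₗ[K] (QQ K ⊗[K] QQ K) where
  toFun v := jV K m (v 0) ⊗ₜ jV K m (v 1) - jV K m (v 1) ⊗ₜ jV K m (v 0)
  map_update_add' v i x y := by
    fin_cases i <;> simp [TensorProduct.add_tmul, TensorProduct.tmul_add] <;> abel
  map_update_smul' v i c x := by
    fin_cases i <;> simp [TensorProduct.smul_tmul', TensorProduct.tmul_smul, smul_sub]
  map_eq_zero_of_eq' v i j h hij := by
    have : v 0 = v 1 := by fin_cases i <;> fin_cases j <;> simp_all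
    simp [this]

def linQ (m : ℤ) : ⋀[K]^2 (V K m) →ₗ[K] (QQ K ⊗[K] QQ K) :=
  exteriorPower.alternatingMapLinearEquiv (altQ K m)

lemma linQ_wedge (m : ℤ) (v w : V K m) : linQ K m (wedge K v w) =
    jV K m v ⊗ₜ jV K m w - jV K m w ⊗ₜ jV K m v := by
  rw [wedge_eq, linQ, exteriorPower.alternatingMapLinearEquiv_apply_ιMulti]
  rfl

def AA (k n : ℤ) : PhiCod K k n →ₗ[K] TT K :=
  TensorProduct.map (S K (k-1)).subtype (TensorProduct.map (S K (k-1)).subtype (linQ K n))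

lemma AA_tmul (k n : ℤ) (f g : S K (k-1)) (v w : V K n) :
    AA K k n (f ⊗ₜ (g ⊗ₜ wedge K v w)) = f.1 ⊗ₜ (g.1 ⊗ₜ (jV K n v ⊗ₜ jV K n w))
      - f.1 ⊗ₜ (g.1 ⊗ₜ (jV K n w ⊗ₜ jV K n v)) := by
  have : AA K k n (f ⊗ₜ (g ⊗ₜ wedge K v w)) = f.1 ⊗ₜ (g.1 ⊗ₜ (linQ K n (wedge K v w))) := rfl
  rw [this, linQ_wedge, TensorProduct.tmul_sub, TensorProduct.tmul_sub]

lemma AA_Phi (k n : ℤ) (Φ : PhiDom K k n →ₗ[K] PhiCod K k n) (hΦ : IsPhi K k n Φ)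
    (z : PhiDom K k n) :
    AA K k n (Φ z) = eF K * jT K (k-2) (n-1) z - sig K (eF K * jT K (k-2) (n-1) z) := by
  induction z using ind4 with
  | h0 => rw [map_zero, map_zero, map_zero, mul_zero, map_zero, sub_zero]
  | hadd x y hx hy => rw [map_add, map_add, hx, hy, map_add, mul_add, map_add]; abel
  | h f g v w =>
    rw [jT_tmul, eF_mul, hΦ]
    simp only [map_add, map_sub, AA_tmul, sig_tmul, mulP_coe, sU_coe, tU_coe,
      jV_mul K _ (sU K) 0 rfl, jV_mul K _ (tU K) 1 rfl]
    abel

def swapE (a m : ℤ) : (S K a) ⊗[K] ((S K a) ⊗[K] (V K m ⊗[K] V K m)) →ₗ[K]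
    (S K a) ⊗[K] ((S K a) ⊗[K] (V K m ⊗[K] V K m)) :=
  TensorProduct.map LinearMap.id (TensorProduct.map LinearMap.id
    (TensorProduct.comm K (V K m) (V K m)).toLinearMap)

lemma swapE_tmul (a m : ℤ) (f g : S K a) (v w : V K m) :
    swapE K a m (f ⊗ₜ (g ⊗ₜ (v ⊗ₜ w))) = f ⊗ₜ (g ⊗ₜ (w ⊗ₜ v)) := rfl

lemma jT_swap (a m : ℤ) (z) : jT K a m (swapE K a m z) = sig K (jT K a m z) := by
  induction z using ind4 with
  | h0 => rw [map_zero, map_zero, map_zero]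
  | hadd x y hx hy => rw [map_add, map_add, hx, hy, map_add, map_add]
  | h f g v w => rw [swapE_tmul, jT_tmul, jT_tmul, sig_tmul]

lemma add_swap_mem (k n : ℤ) (z : EpsDom K k n) : z + swapE K (k-3) (n-2) z ∈
      (Submodule.span K {x : EpsDom K k n |
        ∃ (f f' : S K (k-3)) (u u' : V K (n-2)),
          x = f ⊗ₜ[K] (f' ⊗ₜ[K] (u ⊗ₜ[K] u' + u' ⊗ₜ[K] u))}) := by
  induction z using ind4 with
  | h0 => rw [map_zero, add_zero]; exact Submodule.zero_mem _
  | hadd x y hx hy =>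
    rw [map_add, add_add_add_comm]
    exact Submodule.add_mem _ hx hy
  | h f g v w =>
    apply Submodule.subset_span
    refine ⟨f, g, v, w, ?_⟩
    rw [swapE_tmul, TensorProduct.tmul_add, TensorProduct.tmul_add]

lemma wedge_swap {m : ℤ} (v w : V K m) : wedge K v w = - wedge K w v := by
  rw [wedge_eq, wedge_eq]
  have := (exteriorPower.ιMulti K 2 (M := V K m)).map_swap ![w, v] (i := 0) (j := 1) (by simp)
  rw [← this]
  congr 1
  ext i
  fin_cases i <;> simp

lemma mulP_comm {b c d : ℤ} (h : c = 1 + b) (h' : d = 1 + c) (u u' : S K 1) (f : S K b) :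
    mulP K h' u (mulP K h u' f) = mulP K h' u' (mulP K h u f) := by
  apply Subtype.ext
  simp only [mulP_coe]
  ring

lemma VMul_comm {b c d : ℤ} (h : c = 1 + b) (h' : d = 1 + c) (u u' : S K 1) (v : V K b) :
    VMul K h' u (VMul K h u' v) = VMul K h' u' (VMul K h u v) := by
  induction v using TensorProduct.induction_on with
  | zero => simp
  | add x y hx hy => simp only [map_add, hx, hy]
  | tmul f g => simp [VMul, mulLin, mulP_comm K h h' u u']

lemma Phi_eps (k n : ℤ) (Φ : PhiDom K k n →ₗ[K] PhiCod K k n) (hΦ : IsPhi K k n Φ)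
    (ε : EpsDom K k n →ₗ[K] PhiDom K k n) (hε : IsEps K k n ε)
    (f f' : S K (k-3)) (u u' : V K (n-2)) :
    Φ (ε (f ⊗ₜ[K] (f' ⊗ₜ[K] (u ⊗ₜ[K] u' + u' ⊗ₜ[K] u)))) = 0 := by
  rw [TensorProduct.tmul_add, TensorProduct.tmul_add, map_add, map_add, hε, hε]
  simp only [map_add, map_sub]
  simp only [hΦ _ _ _ _]
  simp only [mulP_comm K _ _ (tU K) (sU K), VMul_comm K _ _ (tU K) (sU K)]
  simp only [wedge_swap K (VMul K _ _ (VMul K _ _ u')) (VMul K _ _ (VMul K _ _ u)), TensorProduct.tmul_neg]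
  abel

/-- Proposition 3.1 of the paper. For all integers `k ≥ 1` and `n ≥ 1`,
the kernel of `Φ^∨` equals the image under `ε'` of the subspace
`S_{k−3} ⊗ S_{k−3} ⊗ Sym²(V_{n−2})`, where `Sym²(V_{n−2}) ⊆ V_{n−2} ⊗ V_{n−2}` is the
subspace of symmetric tensors, spanned by the elements `u ⊗ u' + u' ⊗ u`. -/
theorem statement5 (K : Type) [Field K] [CharZero K] (k n : ℤ) (hk : 1 ≤ k) (hn : 1 ≤ n)
    (Φ : PhiDom K k n →ₗ[K] PhiCod K k n) (hΦ : IsPhi K k n Φ)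
    (ε : EpsDom K k n →ₗ[K] PhiDom K k n) (hε : IsEps K k n ε) :
    LinearMap.ker Φ = Submodule.map ε
      (Submodule.span K {x : EpsDom K k n |
        ∃ (f f' : S K (k-3)) (u u' : V K (n-2)),
          x = f ⊗ₜ[K] (f' ⊗ₜ[K] (u ⊗ₜ[K] u' + u' ⊗ₜ[K] u))}) := by
  apply le_antisymm
  · intro z hz
    rw [LinearMap.mem_ker] at hz
    have h1 := AA_Phi K k n Φ hΦ z
    rw [hz, map_zero, map_mul, sig_eF] at h1
    have h2 := (sub_eq_zero.mp h1.symm)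
    obtain ⟨w, hw⟩ := key_dvd K _ _ h2
    have h3 : z = ε (rT K (k-3) (n-2) w) := by
      rw [← rT_eE K k n ε hε, ← hw, rT_jT]
    set y := rT K (k-3) (n-2) w with hy
    have h4 : jT K (k-3) (n-2) y = sig K (jT K (k-3) (n-2) y) := by
      have h5 : sig K (eE K) = eF K := by rw [← sig_eF, sig_sig]
      rw [h3, jT_eps K k n ε hε, map_mul, h5] at h2
      rw [← sub_eq_zero]
      apply cancelEF
      linear_combination h2
    have h6 : y = swapE K (k-3) (n-2) y := by
      apply jT_inj
      rw [jT_swap]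
      exact h4
    refine ⟨y, ?_, h3.symm⟩
    have h7 := add_swap_mem K k n y
    rw [← h6] at h7
    have h8 := Submodule.smul_mem _ (2⁻¹ : K) h7
    rw [← two_smul K y, smul_smul, inv_mul_cancel₀ two_ne_zero, one_smul] at h8
    exact h8
  · rw [Submodule.map_le_iff_le_comap, Submodule.span_le]
    rintro x ⟨f, f', u, u', rfl⟩
    exact Phi_eps K k n Φ hΦ ε hε f f' u u'
end
end

section
/- For all integers k ≥ 2 and n ≥ 1, the kernel of Φ^∨ has dimension (k−2)²·(2n−1)(n−1) over K, i.e. dim Ker(Φ^∨) = (k−2)²·binom(2n−1, 2). -/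
open scoped TensorProduct
open MvPolynomial

noncomputable section

set_option maxHeartbeats 1000000
set_option synthInstance.maxHeartbeats 1000000

variable (K : Type) [Field K] [CharZero K]

set_option linter.unusedSectionVars false

namespace PhiAux
variable {K : Type} [Field K]

/-- Polynomials in four variables. -/
abbrev P4 (K : Type) [Field K] := MvPolynomial (Fin 4) K

def sub4 (a b : Fin 4) : P4 K →ₐ[K] P4 K := aeval (Function.update X a (X b))

lemma sub4_dvd (a b : Fin 4) (p : P4 K) : (X a - X b : P4 K) ∣ p - sub4 a b p := by
  rw [← Ideal.mem_span_singleton, ← Ideal.Quotient.mk_eq_mk_iff_sub_mem]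
  have : (Ideal.Quotient.mkₐ K (Ideal.span {(X a - X b : P4 K)})) =
      (Ideal.Quotient.mkₐ K (Ideal.span {(X a - X b : P4 K)})).comp (sub4 a b) := by
    apply MvPolynomial.algHom_ext
    intro i
    by_cases h : i = a
    · subst h
      simp only [sub4, AlgHom.comp_apply, aeval_X, Function.update_self, Ideal.Quotient.mkₐ_eq_mk]
      rw [Ideal.Quotient.mk_eq_mk_iff_sub_mem]
      exact Ideal.mem_span_singleton_self _
    · simp [sub4, h]
  exact DFunLike.congr_fun this p

lemma dvd_iff_sub4 (a b : Fin 4) (p : P4 K) : (X a - X b : P4 K) ∣ p ↔ sub4 a b p = 0 := by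
  constructor
  · rintro ⟨q, rfl⟩
    by_cases h : b = a <;> simp [sub4, h]
  · intro h
    simpa [h] using sub4_dvd a b p

lemma prime_sub4 {a b : Fin 4} (hab : a ≠ b) : Prime (X a - X b : P4 K) := by
  refine ⟨?_, ?_, ?_⟩
  · rw [sub_ne_zero]; exact fun h => hab (X_injective h)
  · intro h
    have h1 := isUnit_iff_dvd_one.mp h
    rw [dvd_iff_sub4] at h1
    simp at h1
  · intro p q h
    simpa [dvd_iff_sub4] using h

/-- product `(y₁ - x₁)(y₂ - x₂)`. -/
def DD : P4 K := (X 2 - X 0) * (X 3 - X 1)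
/-- product `(y₂ - x₁)(y₁ - x₂)`. -/
def DD' : P4 K := (X 3 - X 0) * (X 2 - X 1)

lemma not_dvd_aux {a b c d : Fin 4} (h : (Function.update X a (X b) : Fin 4 → P4 K) c ≠
    (Function.update X a (X b) : Fin 4 → P4 K) d) : ¬ (X a - X b : P4 K) ∣ X c - X d := by
  rw [dvd_iff_sub4]
  simpa [sub4, sub_eq_zero] using h

lemma dvd_key {F H : P4 K} (h : DD * F = DD' * H) : DD' ∣ F := by
  have p1 : Prime (X 3 - X 0 : P4 K) := prime_sub4 (by decide)
  have p2 : Prime (X 2 - X 1 : P4 K) := prime_sub4 (by decide)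
  have n1 : ¬ (X 3 - X 0 : P4 K) ∣ DD := by
    intro hd
    rcases p1.dvd_or_dvd hd with hd | hd <;> revert hd <;> apply not_dvd_aux <;>
      simp [X_injective.eq_iff]
  have n2 : ¬ (X 2 - X 1 : P4 K) ∣ DD := by
    intro hd
    rcases p2.dvd_or_dvd hd with hd | hd <;> revert hd <;> apply not_dvd_aux <;>
      simp [X_injective.eq_iff]
  have d1 : (X 3 - X 0 : P4 K) ∣ F := by
    refine (p1.dvd_or_dvd (?_ : _ ∣ DD * F)).resolve_left n1
    rw [h, DD', mul_assoc]; exact dvd_mul_right _ _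
  obtain ⟨F1, rfl⟩ := d1
  have h2 : DD * F1 = (X 2 - X 1) * H := by
    apply mul_left_cancel₀ p1.ne_zero
    rw [DD'] at h
    linear_combination h
  have d2 : (X 2 - X 1 : P4 K) ∣ F1 :=
    (p2.dvd_or_dvd (h2 ▸ dvd_mul_right _ _ : _ ∣ DD * F1)).resolve_left n2
  exact mul_dvd_mul_left _ d2

lemma DD_ne : (DD : P4 K) ≠ 0 :=
  mul_ne_zero (prime_sub4 (by decide)).ne_zero (prime_sub4 (by decide)).ne_zero
lemma DD'_ne : (DD' : P4 K) ≠ 0 :=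
  mul_ne_zero (prime_sub4 (by decide)).ne_zero (prime_sub4 (by decide)).ne_zero

lemma degreeOf_lin (a b i : Fin 4) (hab : a ≠ b) :
    degreeOf i (X a - X b : P4 K) = if i = a ∨ i = b then 1 else 0 := by
  classical
  have hsup : (X a - X b : P4 K).support = {Finsupp.single a 1, Finsupp.single b 1} := by
    have hne : (Finsupp.single a 1 : Fin 4 →₀ ℕ) ≠ Finsupp.single b 1 := by
      intro h; exact hab ((Finsupp.single_left_injective one_ne_zero) h)
    ext m
    rw [mem_support_iff]
    simp only [coeff_sub, coeff_X, Finset.mem_insert, Finset.mem_singleton]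
    by_cases h1 : Finsupp.single a 1 = m
    · subst h1; simp [hne.symm]
    · by_cases h2 : Finsupp.single b 1 = m
      · subst h2; simp [hne]
      · simp [h1, h2, Ne.symm h1, Ne.symm h2]
  rw [degreeOf_eq_sup, hsup]
  simp only [Finset.sup_insert, Finset.sup_singleton, Finsupp.single_apply]
  by_cases h1 : a = i <;> by_cases h2 : b = i <;> simp [h1, h2, eq_comm]

lemma degreeOf_DD' (i : Fin 4) : degreeOf i (DD' : P4 K) = 1 := by
  rw [DD', degreeOf_mul_eq (prime_sub4 (by decide)).ne_zero (prime_sub4 (by decide)).ne_zero,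
    degreeOf_lin _ _ _ (by decide), degreeOf_lin _ _ _ (by decide)]
  fin_cases i <;> rfl

/-- support bounds -/
def Bd (a b : ℕ) (F : P4 K) : Prop :=
  ∀ m ∈ F.support, m 0 < a ∧ m 1 < a ∧ m 2 < b ∧ m 3 < b

lemma Bd_iff (a b : ℕ) (F : P4 K) : Bd a b F ↔
    (F ≠ 0 → degreeOf 0 F < a ∧ degreeOf 1 F < a ∧ degreeOf 2 F < b ∧ degreeOf 3 F < b) := by
  constructor
  · intro h h0
    obtain ⟨m, hm⟩ := Finset.nonempty_iff_ne_empty.mpr (by simpa using h0 : F.support ≠ ∅)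
    have := h m hm
    refine ⟨?_, ?_, ?_, ?_⟩ <;> rw [degreeOf_lt_iff (by omega)] <;> intro m' hm' <;>
      have := h m' hm' <;> tauto
  · intro h m hm
    have h0 : F ≠ 0 := by rintro rfl; simp at hm
    have h1 := fun i => monomial_le_degreeOf i hm
    have := h h0
    have := h1 0; have := h1 1; have := h1 2; have := h1 3
    omega

lemma Bd_DD' (a b : ℕ) (G : P4 K) : Bd (a+1) (b+1) (DD' * G) ↔ Bd a b G := by
  by_cases h : G = 0
  · subst h; simp [Bd]
  · rw [Bd_iff, Bd_iff]
    simp only [ne_eq, mul_eq_zero, DD'_ne, h, or_self, not_false_eq_true, forall_const,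
      degreeOf_mul_eq DD'_ne h, degreeOf_DD']
    omega

/-- swap the `y`'s -/
def sw : P4 K →ₐ[K] P4 K := rename (Equiv.swap 2 3)
lemma sw_DD : sw (DD : P4 K) = DD' := by
  simp only [sw, DD, DD', map_mul, map_sub, rename_X]
  rfl
lemma sw_DD' : sw (DD' : P4 K) = DD := by
  simp only [sw, DD, DD', map_mul, map_sub, rename_X]
  rw [Equiv.swap_apply_left, Equiv.swap_apply_right, Equiv.swap_apply_of_ne_of_ne, Equiv.swap_apply_of_ne_of_ne] <;> decide

/-- exponent vectors -/
def ex (α β μ ν : ℕ) : Fin 4 →₀ ℕ := Finsupp.equivFunOnFinite.symm ![α, β, μ, ν]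

abbrev J (a b : ℕ) := Fin a × (Fin a × ((Fin 2 × Fin b) × (Fin 2 × Fin b)))

abbrev PP (K : Type) [Field K] := Fin 2 → Fin 2 → P4 K

/-- polynomial of a coefficient array -/
def Q (a b : ℕ) : (J a b → K) →ₗ[K] PP K where
  toFun c i j := ∑ α : Fin a, ∑ β : Fin a, ∑ μ : Fin b, ∑ ν : Fin b,
    monomial (ex α β μ ν) (c (α, β, (i, μ), (j, ν)))
  map_add' c d := by
    funext i j
    simp [Finset.sum_add_distrib]
  map_smul' r c := by
    funext i j
    simp [Finset.smul_sum, smul_monomial]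

lemma ex_inj {α β μ ν α' β' μ' ν' : ℕ} :
    ex α β μ ν = ex α' β' μ' ν' ↔ α = α' ∧ β = β' ∧ μ = μ' ∧ ν = ν' := by
  simp [ex]

lemma ex_eta (m : Fin 4 →₀ ℕ) : ex (m 0) (m 1) (m 2) (m 3) = m := by
  ext i; fin_cases i <;> rfl

lemma coeff_Q (a b : ℕ) (c : J a b → K) (i j : Fin 2) (α β : Fin a) (μ ν : Fin b) :
    coeff (ex α β μ ν) (Q a b c i j) = c (α, β, (i, μ), (j, ν)) := by
  classical
  simp only [Q, LinearMap.coe_mk, AddHom.coe_mk, coeff_sum, coeff_monomial, ex_inj, Fin.val_inj]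
  rw [Finset.sum_eq_single α, Finset.sum_eq_single β, Finset.sum_eq_single μ,
    Finset.sum_eq_single ν] <;> simp +contextual

lemma Q_inj (a b : ℕ) : Function.Injective (Q (K := K) a b) := by
  intro c d h
  funext ⟨α, β, ⟨i, μ⟩, ⟨j, ν⟩⟩
  rw [← coeff_Q a b c, ← coeff_Q a b d, h]

lemma Bd_Q (a b : ℕ) (c : J a b → K) (i j : Fin 2) : Bd a b (Q a b c i j) := by
  classical
  intro m hm
  rw [mem_support_iff] at hm
  simp only [Q, LinearMap.coe_mk, AddHom.coe_mk, coeff_sum] at hm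
  obtain ⟨α, -, hm⟩ := Finset.exists_ne_zero_of_sum_ne_zero hm
  obtain ⟨β, -, hm⟩ := Finset.exists_ne_zero_of_sum_ne_zero hm
  obtain ⟨μ, -, hm⟩ := Finset.exists_ne_zero_of_sum_ne_zero hm
  obtain ⟨ν, -, hm⟩ := Finset.exists_ne_zero_of_sum_ne_zero hm
  rw [coeff_monomial] at hm
  have : ex α β μ ν = m := by by_contra h; simp [h] at hm
  subst this
  exact ⟨α.2, β.2, μ.2, ν.2⟩

lemma Q_coeff (a b : ℕ) (F : PP K) (h : ∀ i j, Bd a b (F i j)) :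
    Q a b (fun x => coeff (ex x.1 x.2.1 x.2.2.1.2 x.2.2.2.2) (F x.2.2.1.1 x.2.2.2.1)) = F := by
  funext i j
  ext m
  by_cases hm : m 0 < a ∧ m 1 < a ∧ m 2 < b ∧ m 3 < b
  · obtain ⟨h0, h1, h2, h3⟩ := hm
    have := coeff_Q a b (fun x => coeff (ex x.1 x.2.1 x.2.2.1.2 x.2.2.2.2)
      (F x.2.2.1.1 x.2.2.2.1)) i j ⟨m 0, h0⟩ ⟨m 1, h1⟩ ⟨m 2, h2⟩ ⟨m 3, h3⟩
    simpa [ex_eta] using this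
  · rw [notMem_support_iff.mp (fun h' => hm (Bd_Q a b _ i j m h')),
      notMem_support_iff.mp (fun h' => hm (h i j m h'))]

lemma coeff_sw (α β μ ν : ℕ) (p : P4 K) : coeff (ex α β ν μ) (sw p) = coeff (ex α β μ ν) p := by
  have : ex α β ν μ = Finsupp.mapDomain (Equiv.swap (2 : Fin 4) 3) (ex α β μ ν) := by
    ext i
    rw [Finsupp.mapDomain_equiv_apply]
    fin_cases i <;> rfl
  rw [this, sw, coeff_rename_mapDomain _ (Equiv.injective _)]

abbrev SymIdx (p q : ℕ) := Fin p × Fin p × Sym2 (Fin 2 × Fin q)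

def symE (p q : ℕ) : (SymIdx p q → K) →ₗ[K] (J p q → K) :=
  LinearMap.funLeft K K (fun x : J p q => (x.1, x.2.1, s(x.2.2.1, x.2.2.2)))

def LL (p q : ℕ) : (SymIdx p q → K) →ₗ[K] PP K where
  toFun g i j := DD' * Q p q (symE p q g) i j
  map_add' c d := by funext i j; simp [mul_add]
  map_smul' c d := by funext i j; simp

lemma LL_inj (p q : ℕ) : Function.Injective (LL (K := K) p q) := by
  intro c d h
  have h1 : Q p q (symE p q c) = Q p q (symE p q d) := by
    funext i j
    exact mul_left_cancel₀ DD'_ne (congrFun (congrFun h i) j)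
  have h2 := Q_inj p q h1
  funext ⟨α, β, z⟩
  induction z using Sym2.ind with
  | _ x y => exact congrFun h2 (α, β, x, y)

/-- Characterization of the range of `LL`. -/
lemma range_LL (p q : ℕ) (F : PP K) : F ∈ LinearMap.range (LL (K := K) p q) ↔
    (∀ i j, Bd (p+1) (q+1) (F i j)) ∧ ∀ i j, DD * F i j = sw (DD * F j i) := by
  constructor
  · rintro ⟨g, rfl⟩
    refine ⟨fun i j => (Bd_DD' _ _ _).mpr (Bd_Q _ _ _ _ _), fun i j => ?_⟩
    have : Q p q (symE p q g) i j = sw (Q p q (symE p q g) j i) := by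
      have hB := Bd_Q p q (symE p q g)
      ext m
      rw [← ex_eta m, coeff_sw]
      by_cases hm : m 0 < p ∧ m 1 < p ∧ m 2 < q ∧ m 3 < q
      · obtain ⟨h0, h1, h2, h3⟩ := hm
        have e1 := coeff_Q p q (symE p q g) i j ⟨m 0, h0⟩ ⟨m 1, h1⟩ ⟨m 2, h2⟩ ⟨m 3, h3⟩
        have e2 := coeff_Q p q (symE p q g) j i ⟨m 0, h0⟩ ⟨m 1, h1⟩ ⟨m 3, h3⟩ ⟨m 2, h2⟩
        simp only at e1 e2
        rw [e1, e2]
        simp only [symE, LinearMap.funLeft_apply]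
        rw [Sym2.eq_swap]
      · rw [notMem_support_iff.mp (fun h' => hm (hB i j (ex (m 0) (m 1) (m 2) (m 3)) h')),
          notMem_support_iff.mp (fun h' => hm ?_)]
        have := hB j i _ h'
        simp only [ex, Finsupp.equivFunOnFinite_symm_apply_apply] at this
        exact ⟨this.1, this.2.1, this.2.2.2, this.2.2.1⟩
    simp only [LL, LinearMap.coe_mk, AddHom.coe_mk, map_mul, sw_DD, sw_DD', ← this]
    ring
  · rintro ⟨hB, hS⟩
    have hd : ∀ i j, ∃ G, F i j = DD' * G := fun i j => by
      have := hS i j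
      rw [map_mul, sw_DD] at this
      exact dvd_key this
    choose G hG using hd
    have hGB : ∀ i j, Bd p q (G i j) := fun i j => by
      rw [← Bd_DD', ← hG]; exact hB i j
    have hGS : ∀ i j, G i j = sw (G j i) := fun i j => by
      have := hS i j
      rw [hG i j, hG j i] at this
      simp only [map_mul, sw_DD, sw_DD'] at this
      apply mul_left_cancel₀ (mul_ne_zero DD_ne DD'_ne)
      linear_combination this
    have hQ := Q_coeff p q G hGB
    refine ⟨fun x => Sym2.lift ⟨fun u v => coeff (ex x.1 x.2.1 u.2 v.2) (G u.1 v.1), ?_⟩ x.2.2, ?_⟩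
    · intro u v
      show coeff _ (G u.1 v.1) = coeff _ (G v.1 u.1)
      rw [hGS v.1 u.1, coeff_sw]
    · funext i j
      rw [hG i j]
      simp only [LL, LinearMap.coe_mk, AddHom.coe_mk]
      congr 1
      exact congrFun (congrFun hQ i) j

lemma finrank_LL (p q : ℕ) :
    Module.finrank K (LinearMap.range (LL (K := K) p q)) = p * (p * (2 * q + 1).choose 2) := by
  rw [LinearMap.finrank_range_of_inj (LL_inj p q)]
  simp [Sym2.card]
end PhiAux

namespace PhiAux
section Abstract
variable {K : Type} [Field K]

/-- The alternating map `(v, w) ↦ v ⊗ w - w ⊗ v`. -/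
def altT (K : Type) [Field K] (N : Type) [AddCommGroup N] [Module K N] : N [⋀^Fin 2]→ₗ[K] (N ⊗[K] N) where
  toFun v := v 0 ⊗ₜ v 1 - v 1 ⊗ₜ v 0
  map_update_add' m i x y := by
    fin_cases i <;> simp [TensorProduct.add_tmul, TensorProduct.tmul_add] <;> abel
  map_update_smul' m i c x := by
    fin_cases i <;> simp [TensorProduct.smul_tmul', smul_sub]
  map_eq_zero_of_eq' v i j h hij := by
    fin_cases i <;> fin_cases j <;> simp_all

/-- Embedding of the exterior square into the tensor square. -/
def iotaT (K : Type) [Field K] (N : Type) [AddCommGroup N] [Module K N] : ⋀[K]^2 N →ₗ[K] (N ⊗[K] N) :=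
  exteriorPower.alternatingMapLinearEquiv (altT K N)

variable {N : Type} [AddCommGroup N] [Module K N]

lemma iotaT_apply (v w : N) : iotaT K N (exteriorPower.ιMulti K 2 ![v, w]) = v ⊗ₜ w - w ⊗ₜ v := by
  rw [iotaT, exteriorPower.alternatingMapLinearEquiv_apply_ιMulti]
  rfl

/-- projection -/
def piT (K : Type) [Field K] (N : Type) [AddCommGroup N] [Module K N] : (N ⊗[K] N) →ₗ[K] ⋀[K]^2 N :=
  TensorProduct.lift (LinearMap.mk₂ K (fun v w => exteriorPower.ιMulti K 2 ![v, w])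
    (fun a b c => Subtype.ext (by simp [ExteriorAlgebra.ιMulti_apply, add_mul]))
    (fun a b c => Subtype.ext (by simp [ExteriorAlgebra.ιMulti_apply]))
    (fun a b c => Subtype.ext (by simp [ExteriorAlgebra.ιMulti_apply, mul_add]))
    (fun a b c => Subtype.ext (by simp [ExteriorAlgebra.ιMulti_apply])))

lemma iotaT_inj [CharZero K] : Function.Injective (iotaT K N) := by
  have h : (piT K N) ∘ₗ (iotaT K N) = (2 : K) • LinearMap.id := by
    apply exteriorPower.linearMap_ext
    ext v
    have hv : v = ![v 0, v 1] := by ext i; fin_cases i <;> rfl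
    have hsw : exteriorPower.ιMulti K 2 ![v 1, v 0] = - exteriorPower.ιMulti K 2 ![v 0, v 1] := by
      have := (exteriorPower.ιMulti K 2 (M := N)).map_swap ![v 0, v 1] (i := 0) (j := 1) (by decide)
      rw [← this]
      congr 1
      ext i; fin_cases i <;> simp
    rw [hv]
    simp only [LinearMap.compAlternatingMap_apply, LinearMap.comp_apply, iotaT_apply, map_sub]
    simp only [piT, TensorProduct.lift.tmul, LinearMap.mk₂_apply, hsw]
    simp [two_smul]
  intro x y hxy
  have h1 := DFunLike.congr_fun h x
  have h2 := DFunLike.congr_fun h y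
  simp only [LinearMap.comp_apply, hxy] at h1 h2
  rw [h1] at h2
  simpa using h2

variable {M : Type} [AddCommGroup M] [Module K M]

/-- product of four maps -/
def E4 (f g : M →ₗ[K] P4 K) (u v : N →ₗ[K] P4 K) : M ⊗[K] (M ⊗[K] (N ⊗[K] N)) →ₗ[K] P4 K :=
  LinearMap.mul' K (P4 K) ∘ₗ TensorProduct.map f
    (LinearMap.mul' K (P4 K) ∘ₗ TensorProduct.map g
      (LinearMap.mul' K (P4 K) ∘ₗ TensorProduct.map u v))

lemma E4_tmul (f g : M →ₗ[K] P4 K) (u v : N →ₗ[K] P4 K) (a b : M) (c d : N) :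
    E4 f g u v (a ⊗ₜ (b ⊗ₜ (c ⊗ₜ d))) = f a * (g b * (u c * v d)) := rfl

def dh {a : ℕ} (b : Module.Basis (Fin a) K M) (x : Fin 4) : M →ₗ[K] P4 K :=
  b.constr K (fun α => (X x ^ (α : ℕ) : P4 K))

def vh {a : ℕ} (b : Module.Basis (Fin 2 × Fin a) K N) (i : Fin 2) (y : Fin 4) : N →ₗ[K] P4 K :=
  b.constr K (fun z => if z.1 = i then (X y ^ (z.2 : ℕ) : P4 K) else 0)

lemma dh_basis {a : ℕ} (b : Module.Basis (Fin a) K M) (x : Fin 4) (α : Fin a) :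
    dh b x (b α) = X x ^ (α : ℕ) := by
  rw [dh, Module.Basis.constr_basis]

lemma vh_basis {a : ℕ} (b : Module.Basis (Fin 2 × Fin a) K N) (i : Fin 2) (y : Fin 4)
    (z : Fin 2 × Fin a) :
    vh b i y (b z) = if z.1 = i then (X y ^ (z.2 : ℕ) : P4 K) else 0 := by
  rw [vh, Module.Basis.constr_basis]

def EE {a c : ℕ} (b : Module.Basis (Fin a) K M) (d : Module.Basis (Fin 2 × Fin c) K N) :
    M ⊗[K] (M ⊗[K] (N ⊗[K] N)) →ₗ[K] PP K :=
  LinearMap.pi fun i => LinearMap.pi fun j => E4 (dh b 0) (dh b 1) (vh d i 2) (vh d j 3)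

lemma EE_apply {a c : ℕ} (b : Module.Basis (Fin a) K M) (d : Module.Basis (Fin 2 × Fin c) K N)
    (ξ : M ⊗[K] (M ⊗[K] (N ⊗[K] N))) (i j : Fin 2) :
    EE b d ξ i j = E4 (dh b 0) (dh b 1) (vh d i 2) (vh d j 3) ξ := rfl

lemma monomial_ex (α β μ ν : ℕ) (r : K) : (monomial (ex α β μ ν) r : P4 K) =
    r • (X 0 ^ α * (X 1 ^ β * (X 2 ^ μ * X 3 ^ ν))) := by
  rw [monomial_eq, Finsupp.prod_fintype _ _ (by simp), Fin.prod_univ_four, smul_eq_C_mul]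
  simp [ex, mul_assoc]

/-- tensor basis -/
def TB {a c : ℕ} (b : Module.Basis (Fin a) K M) (d : Module.Basis (Fin 2 × Fin c) K N) :
    Module.Basis (J a c) K (M ⊗[K] (M ⊗[K] (N ⊗[K] N))) :=
  b.tensorProduct (b.tensorProduct (d.tensorProduct d))

lemma EE_eq_Q {a c : ℕ} (b : Module.Basis (Fin a) K M) (d : Module.Basis (Fin 2 × Fin c) K N)
    (ξ : M ⊗[K] (M ⊗[K] (N ⊗[K] N))) :
    EE b d ξ = Q a c ((TB b d).equivFun ξ) := by
  set e := (TB b d).equivFun ξ with he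
  have h1 : ξ = ∑ x, e x • TB b d x := by
    rw [he, Module.Basis.sum_equivFun]
  clear_value e
  subst h1
  have hb : ∀ x : J a c, TB b d x = b x.1 ⊗ₜ (b x.2.1 ⊗ₜ (d x.2.2.1 ⊗ₜ d x.2.2.2)) := by
    intro x
    simp [TB, Module.Basis.tensorProduct_apply']
  funext i j
  rw [EE_apply, map_sum]
  simp only [map_smul, hb, E4_tmul, dh_basis, vh_basis, Fintype.sum_prod_type, Q,
    LinearMap.coe_mk, AddHom.coe_mk, monomial_ex]
  refine Finset.sum_congr rfl fun α _ => Finset.sum_congr rfl fun β _ => ?_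
  rw [Finset.sum_eq_single i]
  · refine Finset.sum_congr rfl fun μ _ => ?_
    rw [Finset.sum_eq_single j]
    · simp
    · intro j' _ hj; simp [hj]
    · simp
  · intro i' _ hi; simp [hi]
  · simp

lemma EE_inj {a c : ℕ} (b : Module.Basis (Fin a) K M) (d : Module.Basis (Fin 2 × Fin c) K N) :
    Function.Injective (EE b d) := by
  intro x y h
  rw [EE_eq_Q, EE_eq_Q] at h
  exact (TB b d).equivFun.injective (Q_inj _ _ h)

lemma EE_range {a c : ℕ} (b : Module.Basis (Fin a) K M) (d : Module.Basis (Fin 2 × Fin c) K N)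
    (F : PP K) : F ∈ LinearMap.range (EE b d) ↔ ∀ i j, Bd a c (F i j) := by
  constructor
  · rintro ⟨ξ, rfl⟩ i j
    rw [EE_eq_Q]; exact Bd_Q _ _ _ _ _
  · intro h
    refine ⟨(TB b d).equivFun.symm (fun x =>
      coeff (ex x.1 x.2.1 x.2.2.1.2 x.2.2.2.2) (F x.2.2.1.1 x.2.2.2.1)), ?_⟩
    rw [EE_eq_Q, LinearEquiv.apply_symm_apply]
    exact Q_coeff a c F h

variable {M' N' : Type} [AddCommGroup M'] [Module K M'] [AddCommGroup N'] [Module K N']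

lemma hom4_ext {P : Type} [AddCommGroup P] [Module K P]
    (F G : M ⊗[K] (M ⊗[K] (N ⊗[K] N)) →ₗ[K] P)
    (h : ∀ a b c d, F (a ⊗ₜ (b ⊗ₜ (c ⊗ₜ d))) = G (a ⊗ₜ (b ⊗ₜ (c ⊗ₜ d)))) : F = G := by
  ext a b c d
  exact h a b c d

theorem abstract_main [CharZero K] (p q : ℕ)
    (b : Module.Basis (Fin (p+1)) K M) (b' : Module.Basis (Fin (p+2)) K M')
    (d : Module.Basis (Fin 2 × Fin (q+1)) K N) (d' : Module.Basis (Fin 2 × Fin (q+2)) K N')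
    (sk tk : M →ₗ[K] M') (sn tn : N →ₗ[K] N')
    (hsk : ∀ α, sk (b α) = b' α.castSucc) (htk : ∀ α, tk (b α) = b' α.succ)
    (hsn : ∀ i μ, sn (d (i, μ)) = d' (i, μ.castSucc)) (htn : ∀ i μ, tn (d (i, μ)) = d' (i, μ.succ))
    (Φ : M ⊗[K] (M ⊗[K] (N ⊗[K] N)) →ₗ[K] M' ⊗[K] (M' ⊗[K] (⋀[K]^2 N')))
    (hΦ : ∀ g g' v v', Φ (g ⊗ₜ (g' ⊗ₜ (v ⊗ₜ v'))) =
        (sk g) ⊗ₜ[K] ((sk g') ⊗ₜ[K] (exteriorPower.ιMulti K 2 ![tn v, tn v']))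
      - (sk g) ⊗ₜ[K] ((tk g') ⊗ₜ[K] (exteriorPower.ιMulti K 2 ![tn v, sn v']))
      - (tk g) ⊗ₜ[K] ((sk g') ⊗ₜ[K] (exteriorPower.ιMulti K 2 ![sn v, tn v']))
      + (tk g) ⊗ₜ[K] ((tk g') ⊗ₜ[K] (exteriorPower.ιMulti K 2 ![sn v, sn v']))) :
    Module.finrank K (LinearMap.ker Φ) = p * (p * (2 * q + 1).choose 2) := by
  let T : M' ⊗[K] (M' ⊗[K] (⋀[K]^2 N')) →ₗ[K] M' ⊗[K] (M' ⊗[K] (N' ⊗[K] N')) :=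
    LinearMap.lTensor M' (LinearMap.lTensor M' (iotaT K N'))
  have hT : Function.Injective T :=
    Module.Flat.lTensor_preserves_injective_linearMap _
      (Module.Flat.lTensor_preserves_injective_linearMap _ iotaT_inj)
  have f1 : ∀ x m, dh b' x (sk m) = dh b x m := fun x => by
    apply DFunLike.congr_fun (f := (dh b' x) ∘ₗ sk)
    apply b.ext; intro α
    simp [hsk, dh_basis]
  have f2 : ∀ x m, dh b' x (tk m) = X x * dh b x m := fun x => by
    apply DFunLike.congr_fun (f := (dh b' x) ∘ₗ tk) (g := LinearMap.mulLeft K (X x) ∘ₗ dh b x)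
    apply b.ext; intro α
    simp [htk, dh_basis, pow_succ']
  have f3 : ∀ i y m, vh d' i y (sn m) = vh d i y m := fun i y => by
    apply DFunLike.congr_fun (f := (vh d' i y) ∘ₗ sn)
    apply d.ext; rintro ⟨i', μ⟩
    simp [hsn, vh_basis]
  have f4 : ∀ i y m, vh d' i y (tn m) = X y * vh d i y m := fun i y => by
    apply DFunLike.congr_fun (f := (vh d' i y) ∘ₗ tn) (g := LinearMap.mulLeft K (X y) ∘ₗ vh d i y)
    apply d.ext; rintro ⟨i', μ⟩
    simp [htn, vh_basis, pow_succ']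
  have w0 : ∀ m, sw (dh b 0 m) = dh b 0 m := by
    apply DFunLike.congr_fun (f := sw.toLinearMap ∘ₗ dh b 0)
    apply b.ext; intro α
    simp only [LinearMap.comp_apply, dh_basis, AlgHom.toLinearMap_apply, map_pow, sw, rename_X]
    rfl
  have w1 : ∀ m, sw (dh b 1 m) = dh b 1 m := by
    apply DFunLike.congr_fun (f := sw.toLinearMap ∘ₗ dh b 1)
    apply b.ext; intro α
    simp only [LinearMap.comp_apply, dh_basis, AlgHom.toLinearMap_apply, map_pow, sw, rename_X]
    rfl
  have w2 : ∀ i m, sw (vh d i 2 m) = vh d i 3 m := fun i => by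
    apply DFunLike.congr_fun (f := sw.toLinearMap ∘ₗ vh d i 2)
    apply d.ext; intro α
    simp only [LinearMap.comp_apply, vh_basis, AlgHom.toLinearMap_apply, sw]
    split_ifs <;> simp
  have w3 : ∀ i m, sw (vh d i 3 m) = vh d i 2 m := fun i => by
    apply DFunLike.congr_fun (f := sw.toLinearMap ∘ₗ vh d i 3)
    apply d.ext; intro α
    simp only [LinearMap.comp_apply, vh_basis, AlgHom.toLinearMap_apply, sw]
    split_ifs <;> simp
  have key : ∀ ξ i j, EE b' d' (T (Φ ξ)) i j = DD * EE b d ξ i j - sw (DD * EE b d ξ j i) := by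
    intro ξ i j
    apply DFunLike.congr_fun
      (f := E4 (dh b' 0) (dh b' 1) (vh d' i 2) (vh d' j 3) ∘ₗ T ∘ₗ Φ)
      (g := LinearMap.mulLeft K DD ∘ₗ E4 (dh b 0) (dh b 1) (vh d i 2) (vh d j 3)
        - sw.toLinearMap ∘ₗ LinearMap.mulLeft K DD ∘ₗ
          E4 (dh b 0) (dh b 1) (vh d j 2) (vh d i 3))
    apply hom4_ext
    intro g g' v v'
    simp only [LinearMap.comp_apply, hΦ, map_add, map_sub, T, LinearMap.lTensor_tmul, iotaT_apply,
      TensorProduct.tmul_sub, E4_tmul, LinearMap.sub_apply, LinearMap.mulLeft_apply,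
      AlgHom.toLinearMap_apply, map_mul, sw_DD, w0, w1, w2, w3, f1, f2, f3, f4]
    simp only [DD, DD']
    ring
  have hker : ∀ ξ, Φ ξ = 0 ↔ ∀ i j, DD * EE b d ξ i j = sw (DD * EE b d ξ j i) := by
    intro ξ
    rw [← (injective_iff_map_eq_zero' T).mp hT, ← (injective_iff_map_eq_zero' _).mp (EE_inj b' d')]
    constructor
    · intro h i j
      rw [← sub_eq_zero, ← key, h]; rfl
    · intro h
      funext i j
      rw [key, h i j, sub_self]; rfl
  have hmap : (LinearMap.ker Φ).map (EE b d) = LinearMap.range (LL p q) := by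
    ext F
    rw [range_LL, ← EE_range b d]
    constructor
    · rintro ⟨ξ, hξ, rfl⟩
      exact ⟨⟨ξ, rfl⟩, (hker ξ).mp hξ⟩
    · rintro ⟨⟨ξ, rfl⟩, h⟩
      exact ⟨ξ, (hker ξ).mpr h, rfl⟩
  rw [← finrank_LL (K := K), ← hmap]
  exact LinearEquiv.finrank_eq (Submodule.equivMapOfInjective _ (EE_inj b d) _)
end Abstract
end PhiAux

namespace PhiAux
section Concrete
variable (K : Type) [Field K] [CharZero K]

def e2 (d i : ℕ) : Fin 2 →₀ ℕ := Finsupp.single 0 (d - i) + Finsupp.single 1 i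

lemma S_eq {m : ℤ} {d : ℕ} (h : m = d) : S K m = homogeneousSubmodule (Fin 2) K d := by
  subst h
  simp [S]

lemma mon_mem {m : ℤ} {d : ℕ} (h : m = d) (i : Fin (d+1)) : (monomial (e2 d i) (1 : K)) ∈ S K m := by
  rw [S_eq K h, mem_homogeneousSubmodule]
  apply isHomogeneous_monomial
  rw [e2, map_add, Finsupp.degree_single, Finsupp.degree_single]
  omega

lemma e2_inj {d : ℕ} {i j : ℕ} : e2 d i = e2 d j ↔ i = j := by
  constructor
  · intro h
    have := DFunLike.congr_fun h 1
    simpa [e2] using this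
  · rintro rfl; rfl

/-- The monomial basis of `S K m`. -/
def bS {m : ℤ} {d : ℕ} (h : m = d) : Module.Basis (Fin (d+1)) K (S K m) :=
  Module.Basis.ofEquivFun
    { toFun := fun f i => coeff (e2 d i) (f : MvPolynomial (Fin 2) K)
      map_add' := fun f g => by funext i; simp
      map_smul' := fun r f => by funext i; simp
      invFun := fun c => ∑ i, c i • (⟨monomial (e2 d i) 1, mon_mem K h i⟩ : S K m)
      left_inv := fun f => by
        classical
        apply Subtype.ext
        have hf : (f : MvPolynomial (Fin 2) K).IsHomogeneous d :=
          (mem_homogeneousSubmodule d _).mp ((S_eq K h).le f.2)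
        ext a
        simp only [AddSubmonoidClass.coe_finsetSum, Submodule.coe_smul, coeff_sum, coeff_smul,
          coeff_monomial, smul_eq_mul, mul_ite, mul_one, mul_zero]
        by_cases ha : a.degree = d
        · have ha2 : a 0 + a 1 = d := by
            rw [Finsupp.degree_eq_sum] at ha; simpa using ha
          have hae : e2 d (a 1) = a := by
            ext i; fin_cases i <;> simp [e2]; omega
          rw [Finset.sum_eq_single ⟨a 1, by omega⟩]
          · simp [hae]
          · intro b _ hb
            rw [if_neg]
            rw [← hae, e2_inj]
            intro h'; exact hb (Fin.ext h')
          · simp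
        · rw [hf.coeff_eq_zero ha]
          apply Finset.sum_eq_zero
          intro i _
          rw [if_neg]
          rintro rfl
          apply ha
          rw [e2, map_add, Finsupp.degree_single, Finsupp.degree_single]
          omega
      right_inv := fun c => by
        classical
        funext i
        simp only [AddSubmonoidClass.coe_finsetSum, Submodule.coe_smul, coeff_sum, coeff_smul,
          coeff_monomial, smul_eq_mul, mul_ite, mul_one, mul_zero, e2_inj, Fin.val_inj]
        simp }

lemma bS_coe {m : ℤ} {d : ℕ} (h : m = d) (i : Fin (d+1)) :
    (bS K h i : MvPolynomial (Fin 2) K) = monomial (e2 d i) 1 := by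
  classical
  rw [bS, Module.Basis.coe_ofEquivFun]
  show ((∑ j, (Pi.single i (1 : K) : Fin (d+1) → K) j •
    (⟨monomial (e2 d j) 1, mon_mem K h j⟩ : S K m) : S K m) : MvPolynomial (Fin 2) K) = _
  rw [Finset.sum_eq_single i]
  · simp
  · intro j _ hj; simp [hj]
  · simp

lemma mul_s {b c : ℤ} {d : ℕ} (h : c = 1 + b) (hb : b = d) (hc : c = (d + 1 : ℕ))
    (α : Fin (d+1)) : mulLin K h (sU K) (bS K hb α) = bS K hc α.castSucc := by
  apply Subtype.ext
  rw [bS_coe]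
  show (X 0 : MvPolynomial (Fin 2) K) * (bS K hb α : MvPolynomial (Fin 2) K) = _
  have he : Finsupp.single 0 1 + e2 d α = e2 (d + 1) (α.castSucc : Fin (d + 1 + 1)) := by
    have := α.2
    ext i; fin_cases i <;> simp [e2] <;> omega
  rw [bS_coe, X, monomial_mul, one_mul, he]

lemma mul_t {b c : ℤ} {d : ℕ} (h : c = 1 + b) (hb : b = d) (hc : c = (d + 1 : ℕ))
    (α : Fin (d+1)) : mulLin K h (tU K) (bS K hb α) = bS K hc α.succ := by
  apply Subtype.ext
  rw [bS_coe]
  show (X 1 : MvPolynomial (Fin 2) K) * (bS K hb α : MvPolynomial (Fin 2) K) = _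
  have he : Finsupp.single 1 1 + e2 d α = e2 (d + 1) (α.succ : Fin (d + 1 + 1)) := by
    have := α.2
    ext i; fin_cases i <;> simp [e2] <;> omega
  rw [bS_coe, X, monomial_mul, one_mul, he]

/-- The basis of `V K m`. -/
def bV {m : ℤ} {d : ℕ} (h : m = d) : Module.Basis (Fin 2 × Fin (d+1)) K (V K m) :=
  (bS K (m := 1) (d := 1) rfl).tensorProduct (bS K h)

lemma vmul_s {b c : ℤ} {d : ℕ} (h : c = 1 + b) (hb : b = d) (hc : c = (d + 1 : ℕ))
    (i : Fin 2) (α : Fin (d+1)) : VMul K h (sU K) (bV K hb (i, α)) = bV K hc (i, α.castSucc) := by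
  rw [bV, bV, Module.Basis.tensorProduct_apply, Module.Basis.tensorProduct_apply, ← mul_s K h hb hc]
  rfl

lemma vmul_t {b c : ℤ} {d : ℕ} (h : c = 1 + b) (hb : b = d) (hc : c = (d + 1 : ℕ))
    (i : Fin 2) (α : Fin (d+1)) : VMul K h (tU K) (bV K hb (i, α)) = bV K hc (i, α.succ) := by
  rw [bV, bV, Module.Basis.tensorProduct_apply, Module.Basis.tensorProduct_apply, ← mul_t K h hb hc]
  rfl
end Concrete
end PhiAux

/-- Theorem 4.1(2) of the paper. For all integers `k ≥ 2` and `n ≥ 1`,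
the kernel of `Φ^∨` has dimension `(k−2)²·(2n−1)(n−1) = (k-2)² • binom(2n-1, 2)` over `K`. -/
theorem statement6 (K : Type) [Field K] [CharZero K] (k n : ℤ) (hk : 2 ≤ k) (hn : 1 ≤ n)
    (Φ : PhiDom K k n →ₗ[K] PhiCod K k n) (hΦ : IsPhi K k n Φ) :
    (Module.finrank K ↥(LinearMap.ker Φ) : ℤ) = (k-2)^2 * ((2*n-1) * (n-1)) := by
  obtain ⟨p, hp⟩ := Int.eq_ofNat_of_zero_le (show 0 ≤ k - 2 by omega)
  obtain ⟨q, hq⟩ := Int.eq_ofNat_of_zero_le (show 0 ≤ n - 1 by omega)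
  have hp' : k - 1 = ((p + 1 : ℕ) : ℤ) := by push_cast; omega
  have hq' : n = ((q + 1 : ℕ) : ℤ) := by push_cast; omega
  have hk1 : k - 1 = 1 + (k - 2) := by ring
  have hn1 : n = 1 + (n - 1) := by ring
  have main := PhiAux.abstract_main p q (PhiAux.bS K hp) (PhiAux.bS K hp')
    (PhiAux.bV K hq) (PhiAux.bV K hq')
    (mulLin K hk1 (sU K)) (mulLin K hk1 (tU K)) (VMul K hn1 (sU K)) (VMul K hn1 (tU K))
    (PhiAux.mul_s K hk1 hp hp') (PhiAux.mul_t K hk1 hp hp')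
    (PhiAux.vmul_s K hn1 hq hq') (PhiAux.vmul_t K hn1 hq hq') Φ
    (fun g g' v v' => hΦ g g' v v')
  have hmain : Module.finrank K ↥(LinearMap.ker Φ) = p * (p * (2 * q + 1).choose 2) := main
  have hch : (2 * q + 1).choose 2 = (2 * q + 1) * q := by
    rw [Nat.choose_two_right, Nat.add_sub_cancel, mul_left_comm, Nat.mul_div_cancel_left _ two_pos]
  rw [hmain, hch, hp]
  have hnq : n = q + 1 := by push_cast at hq'; exact hq'
  rw [hnq]
  push_cast
  ring
end
end

section
/- Let k ≥ 2, n ≥ 1, and let ξ ∈ S_{k−2} ⊗ S_{k−2} ⊗ V_{n−1} ⊗ V_{n−1} be a nonzero element with Φ^∨(ξ) = 0. If the lexicographically smallest index tuple at which ξ has a nonzero coordinate has the form (α, β, μ, ν) with both V-indices unbarred, then 0 < μ ≤ ν. -/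
open scoped TensorProduct
open MvPolynomial

noncomputable section

set_option maxHeartbeats 1000000
set_option synthInstance.maxHeartbeats 1000000

variable (K : Type) [Field K] [CharZero K]

set_option linter.unusedSectionVars false

theorem ext4_aux (K : Type) [Field K] [CharZero K] {A B C D : Type} [AddCommGroup A] [Module K A]
    [AddCommGroup B] [Module K B] [AddCommGroup C] [Module K C] [AddCommGroup D] [Module K D]
    (f g : A ⊗[K] (B ⊗[K] (C ⊗[K] D)) →ₗ[K] K)
    (h : ∀ a b c d, f (a ⊗ₜ[K] (b ⊗ₜ[K] (c ⊗ₜ[K] d))) = g (a ⊗ₜ[K] (b ⊗ₜ[K] (c ⊗ₜ[K] d)))) :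
    f = g := by
  ext a b c d
  simpa using h a b c d

theorem tmulFun_tmul_aux (K : Type) [Field K] [CharZero K] {M N : Type} [AddCommGroup M] [Module K M]
    [AddCommGroup N] [Module K N] (φ : M →ₗ[K] K) (ψ : N →ₗ[K] K) (m : M) (x : N) :
    tmulFun K φ ψ (m ⊗ₜ[K] x) = φ m * ψ x := by
  simp [tmulFun]

theorem coLam_aux (K : Type) [Field K] [CharZero K] {M : Type} [AddCommGroup M] [Module K M]
    (φ ψ : M →ₗ[K] K) (v w : M) (h) :
    coLam K φ ψ ⟨ExteriorAlgebra.ιMulti K 2 ![v, w], h⟩ = φ v * ψ w - φ w * ψ v := by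
  simp only [coLam, LinearMap.comp_apply, Submodule.subtype_apply,
    ExteriorAlgebra.liftAlternating_apply_ιMulti]
  simp [altForm, MultilinearMap.alternatization_apply, Fin.prod_univ_two,
    Finset.univ_perm_fin_succ, Fin.sum_univ_two, ← Finset.univ_product_univ, Finset.sum_product]
  ring

theorem coeffS_s_aux (K : Type) [Field K] [CharZero K] (m c : ℤ) (h : c = 1 + m) (hm : 0 ≤ m) (a : ℤ)
    (f : S K m) : coeffS K c a (mulP K h (sU K) f) = coeffS K m a f := by
  subst h
  by_cases h1 : 0 ≤ a ∧ a ≤ m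
  · have h2 : 0 ≤ a ∧ a ≤ 1 + m := by omega
    simp only [coeffS, if_pos h1, if_pos h2, LinearMap.comp_apply, Submodule.subtype_apply,
      lcoeff_apply, mulP, sU]
    have e : (Finsupp.single (0 : Fin 2) (1 + m - a).toNat + Finsupp.single (1 : Fin 2) a.toNat)
      = Finsupp.single 0 1 + (Finsupp.single (0 : Fin 2) (m - a).toNat +
        Finsupp.single (1 : Fin 2) a.toNat) := by
      rw [← add_assoc, ← Finsupp.single_add]
      congr 2; omega
    rw [e, coeff_X_mul]
  · by_cases h2 : 0 ≤ a ∧ a ≤ 1 + m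
    · have : a = 1 + m := by omega
      subst this
      simp only [coeffS, if_neg h1, if_pos h2, LinearMap.comp_apply, Submodule.subtype_apply,
        lcoeff_apply, mulP, sU]
      rw [coeff_X_mul', if_neg]
      · rfl
      · simp [Finsupp.single_apply]
    · rw [coeffS, coeffS, if_neg h1, if_neg h2]; rfl

theorem coeffS_t_aux (K : Type) [Field K] [CharZero K] (m c : ℤ) (h : c = 1 + m) (hm : 0 ≤ m) (a : ℤ)
    (f : S K m) : coeffS K c a (mulP K h (tU K) f) = coeffS K m (a - 1) f := by
  subst h
  by_cases h1 : 0 ≤ a - 1 ∧ a - 1 ≤ m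
  · have h2 : 0 ≤ a ∧ a ≤ 1 + m := by omega
    simp only [coeffS, if_pos h1, if_pos h2, LinearMap.comp_apply, Submodule.subtype_apply,
      lcoeff_apply, mulP, tU]
    have e : (Finsupp.single (0 : Fin 2) (1 + m - a).toNat + Finsupp.single (1 : Fin 2) a.toNat)
      = Finsupp.single 1 1 + (Finsupp.single (0 : Fin 2) (m - (a - 1)).toNat +
        Finsupp.single (1 : Fin 2) (a - 1).toNat) := by
      rw [add_left_comm, ← Finsupp.single_add]
      congr 2 <;> omega
    rw [e, coeff_X_mul]
  · by_cases h2 : 0 ≤ a ∧ a ≤ 1 + m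
    · have : a = 0 := by omega
      subst this
      simp only [coeffS, if_neg h1, if_pos h2, LinearMap.comp_apply, Submodule.subtype_apply,
        lcoeff_apply, mulP, tU]
      rw [coeff_X_mul', if_neg]
      · rfl
      · simp [Finsupp.single_apply]
    · rw [coeffS, coeffS, if_neg h1, if_neg h2]; rfl

theorem coeffV_s_aux (K : Type) [Field K] [CharZero K] (m c : ℤ) (h : c = 1 + m) (hm : 0 ≤ m) (b : Bool) (a : ℤ)
    (v : V K m) : coeffV K c (b, a) (VMul K h (sU K) v) = coeffV K m (b, a) v := by
  induction v using TensorProduct.induction_on with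
  | zero => simp
  | add x y hx hy => rw [map_add, map_add, map_add, hx, hy]
  | tmul w f =>
    rw [VMul, LinearMap.lTensor_tmul, coeffV, coeffV, tmulFun_tmul_aux, tmulFun_tmul_aux]
    congr 1
    exact coeffS_s_aux K m c h hm a f

theorem coeffV_t_aux (K : Type) [Field K] [CharZero K] (m c : ℤ) (h : c = 1 + m) (hm : 0 ≤ m) (b : Bool) (a : ℤ)
    (v : V K m) : coeffV K c (b, a) (VMul K h (tU K) v) = coeffV K m (b, a - 1) v := by
  induction v using TensorProduct.induction_on with
  | zero => simp
  | add x y hx hy => rw [map_add, map_add, map_add, hx, hy]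
  | tmul w f =>
    rw [VMul, LinearMap.lTensor_tmul, coeffV, coeffV, tmulFun_tmul_aux, tmulFun_tmul_aux]
    congr 1
    exact coeffS_t_aux K m c h hm a f

/-- The coordinate as a linear functional. -/
def cLin (K : Type) [Field K] [CharZero K] (k n : ℤ) (α β : ℤ) (i j : ℤ) : PhiDom K k n →ₗ[K] K :=
  tmulFun K (coeffS K (k-2) α)
    (tmulFun K (coeffS K (k-2) β)
      (tmulFun K (coeffV K (n-1) (false, i)) (coeffV K (n-1) (false, j))))

theorem cLin_tmul (K : Type) [Field K] [CharZero K] (k n : ℤ) (α β : ℤ) (i j : ℤ)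
    (g g' : S K (k-2)) (v v' : V K (n-1)) :
    cLin K k n α β i j (g ⊗ₜ[K] (g' ⊗ₜ[K] (v ⊗ₜ[K] v'))) =
      coeffS K (k-2) α g * (coeffS K (k-2) β g' *
        (coeffV K (n-1) (false, i) v * coeffV K (n-1) (false, j) v')) := by
  rw [cLin, tmulFun_tmul_aux, tmulFun_tmul_aux, tmulFun_tmul_aux]

/-- The target coordinate as a linear functional. -/
def dLin (K : Type) [Field K] [CharZero K] (k n : ℤ) (α β : ℤ) (i j : ℤ) : PhiCod K k n →ₗ[K] K :=
  tmulFun K (coeffS K (k-1) α)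
    (tmulFun K (coeffS K (k-1) β)
      (coLam K (coeffV K n (false, i)) (coeffV K n (false, j))))

theorem dLin_tmul (K : Type) [Field K] [CharZero K] (k n : ℤ) (α β : ℤ) (i j : ℤ)
    (g g' : S K (k-1)) (v v' : V K n) :
    dLin K k n α β i j (g ⊗ₜ[K] (g' ⊗ₜ[K] (wedge K v v'))) =
      coeffS K (k-1) α g * (coeffS K (k-1) β g' *
        (coeffV K n (false, i) v * coeffV K n (false, j) v'
          - coeffV K n (false, i) v' * coeffV K n (false, j) v)) := by
  rw [dLin, tmulFun_tmul_aux, tmulFun_tmul_aux, wedge, coLam_aux]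

/-- Half of the kernel equation. -/
def psi (K : Type) [Field K] [CharZero K] (k n : ℤ) (a b i j : ℤ) : PhiDom K k n →ₗ[K] K :=
  cLin K k n a b (i-1) (j-1) - cLin K k n a (b-1) (i-1) j
    - cLin K k n (a-1) b i (j-1) + cLin K k n (a-1) (b-1) i j

theorem key_aux (K : Type) [Field K] [CharZero K] (k n : ℤ) (hk : 2 ≤ k) (hn : 1 ≤ n)
    (Φ : PhiDom K k n →ₗ[K] PhiCod K k n) (hΦ : IsPhi K k n Φ) (a b i j : ℤ) :
    (dLin K k n a b i j) ∘ₗ Φ = psi K k n a b i j - psi K k n a b j i := by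
  apply ext4_aux
  intro g g' v v'
  have h2 : 0 ≤ k - 2 := by omega
  have h1 : 0 ≤ n - 1 := by omega
  rw [LinearMap.comp_apply, hΦ]
  simp only [map_add, map_sub, dLin_tmul, coeffS_s_aux K _ _ _ h2, coeffS_t_aux K _ _ _ h2,
    coeffV_s_aux K _ _ _ h1, coeffV_t_aux K _ _ _ h1, psi, LinearMap.sub_apply,
    LinearMap.add_apply, cLin_tmul]
  ring

theorem cLin_range (K : Type) [Field K] [CharZero K] (k n : ℤ) (a b i j : ℤ) (ξ : PhiDom K k n)
    (h : i < 0 ∨ j < 0) : cLin K k n a b i j ξ = 0 := by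
  have : cLin K k n a b i j = 0 := by
    apply ext4_aux
    intro g g' v v'
    rw [cLin_tmul]
    have hz : ∀ i : ℤ, i < 0 → coeffV K (n-1) (false, i) = 0 := by
      intro i hi
      have : coeffS K (n-1) i = 0 := by
        rw [coeffS, if_neg (by omega)]
      simp only [coeffV, this, tmulFun, TensorProduct.map_zero_right, LinearMap.comp_zero]
    rcases h with h | h <;> simp [hz _ h]
  rw [this]; rfl

/-- Lemma 3.3(i) of the paper. Let `k ≥ 2`, `n ≥ 1`, and let `ξ` be a
nonzero element of `S_{k−2} ⊗ S_{k−2} ⊗ V_{n−1} ⊗ V_{n−1}` with `Φ^∨(ξ) = 0`. If the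
lexicographically smallest index tuple at which `ξ` has a nonzero coordinate has the
form `(α, β, μ, ν)` with both `V`-indices unbarred, then `0 < μ ≤ ν`. -/
theorem statement9 (K : Type) [Field K] [CharZero K] (k n : ℤ) (hk : 2 ≤ k) (hn : 1 ≤ n)
    (ξ : PhiDom K k n) (hξ : ξ ≠ 0)
    (Φ : PhiDom K k n →ₗ[K] PhiCod K k n) (hΦ : IsPhi K k n Φ) (hker : Φ ξ = 0)
    (α β μ ν : ℤ)
    (hfirst : IsFirstNonzero K k n ξ (α, β, (false, μ), (false, ν))) :
    0 < μ ∧ μ ≤ ν := by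
  have hk' : ∀ a b i j : ℤ, psi K k n a b i j ξ = psi K k n a b j i ξ := by
    intro a b i j
    have h := LinearMap.congr_fun (key_aux K k n hk hn Φ hΦ a b i j) ξ
    rw [LinearMap.comp_apply, hker, map_zero, LinearMap.sub_apply] at h
    exact (sub_eq_zero.mp h.symm)
  obtain ⟨hne, hmin⟩ := hfirst
  have hne' : cLin K k n α β μ ν ξ ≠ 0 := hne
  have hlt1 : ∀ a b i j : ℤ, a < α → cLin K k n a b i j ξ = 0 := fun a b i j h =>
    hmin (a, b, (false, i), (false, j)) (Prod.Lex.left _ _ h)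
  have hlt2 : ∀ b i j : ℤ, b < β → cLin K k n α b i j ξ = 0 := fun b i j h =>
    hmin (α, b, (false, i), (false, j)) (Prod.Lex.right _ (Prod.Lex.left _ _ h))
  have hlt3 : ∀ i j : ℤ, i < μ → cLin K k n α β i j ξ = 0 := fun i j h =>
    hmin (α, β, (false, i), (false, j))
      (Prod.Lex.right _ (Prod.Lex.right _ (Prod.Lex.left _ _ (Prod.Lex.right _ h))))
  have hsym : cLin K k n α β μ ν ξ = cLin K k n α β ν μ ξ := by
    have h := hk' α β (μ + 1) (ν + 1)
    simpa [psi, hlt1 (α - 1) _ _ _ (by omega), hlt2 (β - 1) _ _ (by omega)] using h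
  have hμ : 0 ≤ μ := by
    by_contra h
    exact hne' (cLin_range K k n _ _ _ _ _ (Or.inl (by omega)))
  refine ⟨?_, ?_⟩
  · by_contra h
    have h0 : μ = 0 := by omega
    subst h0
    have h := hk' α (β + 1) (ν + 1) 0
    simp only [psi, LinearMap.sub_apply, LinearMap.add_apply,
      hlt1 (α - 1) _ _ _ (by omega), cLin_range K k n _ _ (0 - 1) _ ξ (Or.inl (by omega)),
      cLin_range K k n _ _ _ (0 - 1) ξ (Or.inr (by omega)), add_sub_cancel_right] at h
    apply hne'
    rw [hsym]
    simpa using h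
  · by_contra h
    exact hne' (hsym.trans (hlt3 _ _ (by omega)))
end
end
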